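/- arXiv:1104.5700 — 14 statements merged into one kernel-verified Lean document; each statement's English description precedes it below -/
import Mathlib

section
/- For every n ≥ 2 and all P, Q ∈ Γₙ, the following chain of inequalities holds: (1/4)Δ(P||Q) ≤ I(P||Q) ≤ h(P||Q) ≤ 4·d(P||Q) ≤ (1/8)J(P||Q) ≤ T(P||Q) ≤ (1/16)Ψ(P||Q). -/
open Real BigOperators Finset

/-- The set of positive probability distributions on `Fin n`. -/
def ProbDist (n : ℕ) : Set (Fin n → ℝ) :=
  {p | (∀ i, 0 < p i) ∧ ∑ i, p i = 1}

/-- Triangular discrimination `Δ(P‖Q)`. -/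
noncomputable def triDelta {n : ℕ} (p q : Fin n → ℝ) : ℝ :=
  ∑ i, (p i - q i) ^ 2 / (p i + q i)

/-- Hellinger discrimination `h(P‖Q)`. -/
noncomputable def hellinger {n : ℕ} (p q : Fin n → ℝ) : ℝ :=
  (1 / 2) * ∑ i, (Real.sqrt (p i) - Real.sqrt (q i)) ^ 2

/-- Jensen–Shannon divergence `I(P‖Q)`. -/
noncomputable def jsDiv {n : ℕ} (p q : Fin n → ℝ) : ℝ :=
  (1 / 2) * ((∑ i, p i * Real.log (2 * p i / (p i + q i))) +
    ∑ i, q i * Real.log (2 * q i / (p i + q i)))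

/-- J-divergence `J(P‖Q)`. -/
noncomputable def jDiv {n : ℕ} (p q : Fin n → ℝ) : ℝ :=
  ∑ i, (p i - q i) * Real.log (p i / q i)

/-- Arithmetic–geometric mean divergence `T(P‖Q)`. -/
noncomputable def agDiv {n : ℕ} (p q : Fin n → ℝ) : ℝ :=
  ∑ i, ((p i + q i) / 2) * Real.log ((p i + q i) / (2 * Real.sqrt (p i * q i)))

/-- Symmetric chi-square divergence `Ψ(P‖Q)`. -/
noncomputable def psiDiv {n : ℕ} (p q : Fin n → ℝ) : ℝ :=
  ∑ i, (p i - q i) ^ 2 * (p i + q i) / (p i * q i)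

/-- The d-divergence `d(P‖Q)`. -/
noncomputable def dDiv {n : ℕ} (p q : Fin n → ℝ) : ℝ :=
  1 - ∑ i, ((Real.sqrt (p i) + Real.sqrt (q i)) / 2) * Real.sqrt ((p i + q i) / 2)

/-- A function on `[0, 1)` vanishing at `0` with nonnegative derivative is nonnegative. -/
lemma nonneg_of_hasDerivAt_of_zero {f f' : ℝ → ℝ} (h0 : f 0 = 0)
    (hd : ∀ x, 0 ≤ x → x < 1 → HasDerivAt f (f' x) x)
    (hf' : ∀ x, 0 < x → x < 1 → 0 ≤ f' x) {t : ℝ} (ht0 : 0 ≤ t) (ht1 : t < 1) : 0 ≤ f t := by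
  have hmono : MonotoneOn f (Set.Ico 0 1) := by
    refine monotoneOn_of_hasDerivWithinAt_nonneg (f' := f') (convex_Ico 0 1)
      (fun x hx ↦ (hd x hx.1 hx.2).continuousAt.continuousWithinAt) ?_ ?_
    · intro x hx
      rw [interior_Ico] at hx
      exact (hd x hx.1.le hx.2).hasDerivWithinAt
    · intro x hx
      rw [interior_Ico] at hx
      exact hf' x hx.1 hx.2
  simpa [h0] using hmono ⟨le_rfl, one_pos⟩ ⟨ht0, ht1⟩ ht0

/-- An even predicate that holds on `[0, 1)` holds on `(-1, 1)`. -/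
lemma forall_abs_lt_one_of_even {P : ℝ → Prop} (heven : ∀ t, P (-t) → P t)
    (h : ∀ t, 0 ≤ t → t < 1 → P t) {t : ℝ} (ht : |t| < 1) : P t := by
  rcases abs_lt.1 ht with ⟨h1, h2⟩
  rcases le_total 0 t with h0 | h0
  · exact h t h0 h2
  · exact heven t (h (-t) (by linarith) (by linarith))

lemma hasDerivAt_log_one_add {x : ℝ} (hx : 0 < 1 + x) :
    HasDerivAt (fun t : ℝ ↦ log (1 + t)) (1 / (1 + x)) x :=
  ((hasDerivAt_id x).const_add 1).log hx.ne'

lemma hasDerivAt_log_one_sub {x : ℝ} (hx : 0 < 1 - x) :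
    HasDerivAt (fun t : ℝ ↦ log (1 - t)) (-1 / (1 - x)) x :=
  ((hasDerivAt_id x).const_sub 1).log hx.ne'

lemma hasDerivAt_mul_log_add_mul_log {x : ℝ} (h1 : 0 < 1 + x) (h2 : 0 < 1 - x) :
    HasDerivAt (fun t : ℝ ↦ (1 + t) * log (1 + t) + (1 - t) * log (1 - t))
      (log (1 + x) - log (1 - x)) x := by
  refine ((((hasDerivAt_id x).const_add 1).mul (hasDerivAt_log_one_add h1)).add
    (((hasDerivAt_id x).const_sub 1).mul (hasDerivAt_log_one_sub h2))).congr_deriv ?_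
  simp only [id_eq]
  field_simp
  ring

lemma two_mul_add_le_log_sub_log {u : ℝ} (h0 : 0 ≤ u) (h1 : u < 1) :
    2 * u + 2 * u ^ 3 / 3 ≤ log (1 + u) - log (1 - u) := by
  have h := sum_range_le_log_div h0 h1 2
  rw [log_div (by linarith) (by linarith)] at h
  norm_num [Finset.sum_range_succ] at h
  linarith

lemma log_le_half_sub_inv {x : ℝ} (hx : 1 ≤ x) : log x ≤ (x - x⁻¹) / 2 := by
  have h := self_le_sinh_iff.2 (log_nonneg hx)
  rwa [sinh_log (by linarith)] at h

lemma log_sub_log_le_div {t : ℝ} (h0 : 0 ≤ t) (h1 : t < 1) :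
    log (1 + t) - log (1 - t) ≤ 2 * t / ((1 + t) * (1 - t)) := by
  have hs : 0 < 1 - t := by linarith
  have h := log_le_half_sub_inv (x := (1 + t) / (1 - t)) (by rw [le_div_iff₀ hs]; linarith)
  rw [log_div (by linarith) hs.ne'] at h
  refine h.trans_eq ?_
  have : 1 + t ≠ 0 := by linarith
  field_simp
  ring

lemma log_sub_log_le_div_sqrt {t : ℝ} (h0 : 0 ≤ t) (h1 : t < 1) :
    log (1 + t) - log (1 - t) ≤ 2 * t / √(1 - t ^ 2) := by
  have hs : 0 < 1 - t := by linarith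
  have ha : 0 < 1 + t := by linarith
  have hx : 1 ≤ √(1 + t) / √(1 - t) := by
    rw [le_div_iff₀ (sqrt_pos.2 hs), one_mul]
    exact sqrt_le_sqrt (by linarith)
  have h := log_le_half_sub_inv hx
  rw [log_div (sqrt_pos.2 ha).ne' (sqrt_pos.2 hs).ne', log_sqrt ha.le, log_sqrt hs.le] at h
  have he : √(1 + t) / √(1 - t) - (√(1 + t) / √(1 - t))⁻¹ = 2 * t / √(1 - t ^ 2) := by
    rw [show 1 - t ^ 2 = (1 + t) * (1 - t) by ring, sqrt_mul ha.le]
    have := (sqrt_pos.2 hs).ne'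
    have := (sqrt_pos.2 ha).ne'
    field_simp
    rw [sq_sqrt ha.le, sq_sqrt hs.le]
    ring
  linarith

lemma sq_le_mul_log_add_mul_log {t : ℝ} (ht : |t| < 1) :
    t ^ 2 ≤ (1 + t) * log (1 + t) + (1 - t) * log (1 - t) := by
  refine forall_abs_lt_one_of_even
    (P := fun t ↦ t ^ 2 ≤ (1 + t) * log (1 + t) + (1 - t) * log (1 - t))
    (fun t h ↦ ?_) (fun t h0 h1 ↦ ?_) ht
  · simpa [sub_eq_add_neg, add_comm] using h
  · refine sub_nonneg.1 (nonneg_of_hasDerivAt_of_zero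
      (f := fun t ↦ (1 + t) * log (1 + t) + (1 - t) * log (1 - t) - t ^ 2)
      (f' := fun x ↦ log (1 + x) - log (1 - x) - 2 * x) (by simp) (fun x hx0 hx1 ↦ ?_)
      (fun x hx0 hx1 ↦ ?_) h0 h1)
    · exact ((hasDerivAt_mul_log_add_mul_log (by linarith) (by linarith)).sub
        (hasDerivAt_pow 2 x)).congr_deriv (by simp)
    · have := two_mul_add_le_log_sub_log hx0.le hx1
      have : 0 ≤ 2 * x ^ 3 / 3 := by positivity
      linarith

lemma mul_log_add_mul_log_le {t : ℝ} (ht : |t| < 1) :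
    (1 + t) * log (1 + t) + (1 - t) * log (1 - t) ≤ 2 - 2 * √(1 - t ^ 2) := by
  refine forall_abs_lt_one_of_even
    (P := fun t ↦ (1 + t) * log (1 + t) + (1 - t) * log (1 - t) ≤ 2 - 2 * √(1 - t ^ 2))
    (fun t h ↦ ?_) (fun t h0 h1 ↦ ?_) ht
  · simpa [sub_eq_add_neg, add_comm] using h
  · refine sub_nonneg.1 (nonneg_of_hasDerivAt_of_zero
      (f := fun t ↦ 2 - 2 * √(1 - t ^ 2) - ((1 + t) * log (1 + t) + (1 - t) * log (1 - t)))
      (f' := fun x ↦ 2 * x / √(1 - x ^ 2) - (log (1 + x) - log (1 - x))) (by simp)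
      (fun x hx0 hx1 ↦ ?_) (fun x hx0 hx1 ↦ sub_nonneg.2 (log_sub_log_le_div_sqrt hx0.le hx1))
      h0 h1)
    have hx : 0 < 1 - x ^ 2 := by nlinarith
    refine (((((hasDerivAt_pow 2 x).const_sub 1).sqrt hx.ne').const_mul 2).const_sub 2 |>.sub
      (hasDerivAt_mul_log_add_mul_log (by linarith) (by linarith))).congr_deriv ?_
    have := (sqrt_pos.2 hx).ne'
    field_simp
    push_cast
    ring

lemma mul_log_sub_log_le {t : ℝ} (ht : |t| < 1) :
    t * (log (1 + t) - log (1 - t)) ≤ -2 * (log (1 + t) + log (1 - t)) := by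
  refine forall_abs_lt_one_of_even
    (P := fun t ↦ t * (log (1 + t) - log (1 - t)) ≤ -2 * (log (1 + t) + log (1 - t)))
    (fun t h ↦ ?_) (fun t h0 h1 ↦ ?_) ht
  · simp only [sub_neg_eq_add, ← sub_eq_add_neg] at h
    linarith
  · refine sub_nonneg.1 (nonneg_of_hasDerivAt_of_zero
      (f := fun t ↦ -2 * (log (1 + t) + log (1 - t)) - t * (log (1 + t) - log (1 - t)))
      (f' := fun x ↦ 2 * x / ((1 + x) * (1 - x)) - (log (1 + x) - log (1 - x))) (by simp)
      (fun x hx0 hx1 ↦ ?_) (fun x hx0 hx1 ↦ sub_nonneg.2 (log_sub_log_le_div hx0.le hx1)) h0 h1)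
    have ha : 0 < 1 + x := by linarith
    have hs : 0 < 1 - x := by linarith
    have hl := hasDerivAt_log_one_add ha
    have hr := hasDerivAt_log_one_sub hs
    refine (((hl.add hr).const_mul (-2)).sub ((hasDerivAt_id x).mul (hl.sub hr))).congr_deriv ?_
    simp only [id_eq, Pi.sub_apply]
    field_simp
    ring

/-- Two positive reals are `c * (1 + t)` and `c * (1 - t)` with `c` their arithmetic mean. -/
lemma exists_eq_mul_one_add_one_sub {p q : ℝ} (hp : 0 < p) (hq : 0 < q) :
    ∃ c t : ℝ, 0 < c ∧ |t| < 1 ∧ p = c * (1 + t) ∧ q = c * (1 - t) := by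
  refine ⟨(p + q) / 2, (p - q) / (p + q), by positivity, ?_, ?_, ?_⟩
  · rw [abs_lt, lt_div_iff₀ (by positivity), div_lt_iff₀ (by positivity)]
    constructor <;> linarith
  all_goals
    field_simp
    ring

lemma triangular_le_jensenShannon {p q : ℝ} (hp : 0 < p) (hq : 0 < q) :
    (1 / 4) * ((p - q) ^ 2 / (p + q)) ≤
      (1 / 2) * (p * log (2 * p / (p + q)) + q * log (2 * q / (p + q))) := by
  obtain ⟨c, t, hc, ht, rfl, rfl⟩ := exists_eq_mul_one_add_one_sub hp hq
  have h := mul_le_mul_of_nonneg_left (sq_le_mul_log_add_mul_log ht) hc.le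
  have e1 : 2 * (c * (1 + t)) / (c * (1 + t) + c * (1 - t)) = 1 + t := by
    rw [← mul_add]; field_simp; ring
  have e2 : 2 * (c * (1 - t)) / (c * (1 + t) + c * (1 - t)) = 1 - t := by
    rw [← mul_add]; field_simp; ring
  have e3 : (c * (1 + t) - c * (1 - t)) ^ 2 / (c * (1 + t) + c * (1 - t)) = 2 * (c * t ^ 2) := by
    rw [← mul_add, ← mul_sub]; field_simp; ring
  rw [e1, e2, e3]
  linarith

lemma jensenShannon_le_hellinger {p q : ℝ} (hp : 0 < p) (hq : 0 < q) :
    (1 / 2) * (p * log (2 * p / (p + q)) + q * log (2 * q / (p + q))) ≤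
      (1 / 2) * (√p - √q) ^ 2 := by
  have e0 : (√p - √q) ^ 2 = p + q - 2 * √(p * q) := by
    rw [sub_sq, sq_sqrt hp.le, sq_sqrt hq.le, sqrt_mul hp.le]; ring
  rw [e0]
  obtain ⟨c, t, hc, ht, rfl, rfl⟩ := exists_eq_mul_one_add_one_sub hp hq
  have h := mul_le_mul_of_nonneg_left (mul_log_add_mul_log_le ht) hc.le
  have e1 : 2 * (c * (1 + t)) / (c * (1 + t) + c * (1 - t)) = 1 + t := by
    rw [← mul_add]; field_simp; ring
  have e2 : 2 * (c * (1 - t)) / (c * (1 + t) + c * (1 - t)) = 1 - t := by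
    rw [← mul_add]; field_simp; ring
  have e3 : √(c * (1 + t) * (c * (1 - t))) = c * √(1 - t ^ 2) := by
    rw [show c * (1 + t) * (c * (1 - t)) = c ^ 2 * (1 - t ^ 2) by ring, sqrt_mul (sq_nonneg c),
      sqrt_sq hc.le]
  rw [e1, e2, e3]
  linarith

lemma hellinger_le_four_mul_d {p q : ℝ} (hp : 0 < p) (hq : 0 < q) :
    (1 / 2) * (√p - √q) ^ 2 ≤ 4 * ((p + q) / 2 - (√p + √q) / 2 * √((p + q) / 2)) := by
  have h1 := sq_sqrt hp.le
  have h2 := sq_sqrt hq.le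
  have h3 := sq_sqrt (show 0 ≤ (p + q) / 2 by positivity)
  nlinarith [sq_nonneg (√((p + q) / 2) - (√p + √q) / 2)]

lemma one_add_sub_sq_le_sqrt_one_add {v : ℝ} (h0 : 0 ≤ v) (h1 : v ≤ 1) :
    1 + v / 2 - v ^ 2 / 8 ≤ √(1 + v) := by
  refine le_sqrt_of_sq_le ?_
  have : 0 ≤ v ^ 3 * (8 - v) := mul_nonneg (by positivity) (by linarith)
  nlinarith

lemma four_mul_d_le_jDiv_of_le {p q : ℝ} (hq : 0 < q) (hqp : q ≤ p) :
    4 * ((p + q) / 2 - (√p + √q) / 2 * √((p + q) / 2)) ≤ (1 / 8) * ((p - q) * log (p / q)) := by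
  have hp : 0 < p := hq.trans_le hqp
  obtain ⟨s, u, hs, hu, hpu, hqu⟩ :=
    exists_eq_mul_one_add_one_sub (sqrt_pos.2 hp) (sqrt_pos.2 hq)
  have hu0 : 0 ≤ u := by
    have := sqrt_le_sqrt hqp
    rw [hpu, hqu] at this
    nlinarith
  have hu1 : u < 1 := (abs_lt.1 hu).2
  have hp2 : p = s ^ 2 * (1 + u) ^ 2 := by rw [← mul_pow, ← hpu, sq_sqrt hp.le]
  have hq2 : q = s ^ 2 * (1 - u) ^ 2 := by rw [← mul_pow, ← hqu, sq_sqrt hq.le]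
  have hm : √((p + q) / 2) = s * √(1 + u ^ 2) := by
    rw [show (p + q) / 2 = s ^ 2 * (1 + u ^ 2) by rw [hp2, hq2]; ring, sqrt_mul (sq_nonneg s),
      sqrt_sq hs.le]
  have hlog : log (p / q) = 2 * (log (1 + u) - log (1 - u)) := by
    have h1 : 1 + u ≠ 0 := by linarith
    have h2 : 1 - u ≠ 0 := by linarith
    rw [hp2, hq2, mul_div_mul_left _ _ (by positivity), ← div_pow, log_pow, log_div h1 h2]
    norm_num
  have hsqrt := one_add_sub_sq_le_sqrt_one_add (sq_nonneg u) (by nlinarith)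
  have hL := mul_le_mul_of_nonneg_left (two_mul_add_le_log_sub_log hu0 hu1) hu0
  have key : 4 * (1 + u ^ 2 - √(1 + u ^ 2)) ≤ u * (log (1 + u) - log (1 - u)) := by
    have : 0 ≤ u ^ 4 := by positivity
    nlinarith
  have := mul_le_mul_of_nonneg_left key (sq_nonneg s)
  rw [hm, hlog, hpu, hqu]
  calc _ = s ^ 2 * (4 * (1 + u ^ 2 - √(1 + u ^ 2))) := by rw [hp2, hq2]; ring
    _ ≤ _ := this
    _ = _ := by rw [hp2, hq2]; ring

lemma four_mul_d_le_jDiv {p q : ℝ} (hp : 0 < p) (hq : 0 < q) :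
    4 * ((p + q) / 2 - (√p + √q) / 2 * √((p + q) / 2)) ≤ (1 / 8) * ((p - q) * log (p / q)) := by
  rcases le_total q p with h | h
  · exact four_mul_d_le_jDiv_of_le hq h
  · have := four_mul_d_le_jDiv_of_le hp h
    rw [log_div hq.ne' hp.ne'] at this
    rw [log_div hp.ne' hq.ne', add_comm p q, add_comm √p √q]
    linarith

lemma log_arith_div_geom {c t : ℝ} (hc : 0 < c) (ht : |t| < 1) :
    log ((c * (1 + t) + c * (1 - t)) / (2 * √(c * (1 + t) * (c * (1 - t))))) =
      -(log (1 + t) + log (1 - t)) / 2 := by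
  obtain ⟨h1, h2⟩ := abs_lt.1 ht
  have ha : 0 < 1 + t := by linarith
  have hs : 0 < 1 - t := by linarith
  have hpos : 0 < (1 + t) * (1 - t) := mul_pos ha hs
  rw [show c * (1 + t) * (c * (1 - t)) = c ^ 2 * ((1 + t) * (1 - t)) by ring,
    sqrt_mul (sq_nonneg c), sqrt_sq hc.le,
    show c * (1 + t) + c * (1 - t) = 2 * c * 1 by ring, ← mul_assoc,
    mul_div_mul_left _ _ (by positivity), log_div one_ne_zero (sqrt_pos.2 hpos).ne', log_one,
    log_sqrt hpos.le, log_mul ha.ne' hs.ne']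
  ring

lemma jDiv_le_agDiv {p q : ℝ} (hp : 0 < p) (hq : 0 < q) :
    (1 / 8) * ((p - q) * log (p / q)) ≤ (p + q) / 2 * log ((p + q) / (2 * √(p * q))) := by
  obtain ⟨c, t, hc, ht, rfl, rfl⟩ := exists_eq_mul_one_add_one_sub hp hq
  have h := mul_le_mul_of_nonneg_left (mul_log_sub_log_le ht) hc.le
  obtain ⟨h1, h2⟩ := abs_lt.1 ht
  rw [log_arith_div_geom hc ht, mul_div_mul_left _ _ hc.ne', log_div (by linarith) (by linarith)]
  linarith

lemma agDiv_le_psiDiv {p q : ℝ} (hp : 0 < p) (hq : 0 < q) :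
    (p + q) / 2 * log ((p + q) / (2 * √(p * q))) ≤
      (1 / 16) * ((p - q) ^ 2 * (p + q) / (p * q)) := by
  obtain ⟨c, t, hc, ht, rfl, rfl⟩ := exists_eq_mul_one_add_one_sub hp hq
  obtain ⟨h1, h2⟩ := abs_lt.1 ht
  have ha : 0 < 1 + t := by linarith
  have hs : 0 < 1 - t := by linarith
  have h := one_sub_inv_le_log_of_pos (mul_pos ha hs)
  rw [log_mul ha.ne' hs.ne'] at h
  have e : (c * (1 + t) - c * (1 - t)) ^ 2 * (c * (1 + t) + c * (1 - t)) /
      (c * (1 + t) * (c * (1 - t))) = 8 * (c * (((1 + t) * (1 - t))⁻¹ - 1)) := by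
    field_simp
    ring
  rw [log_arith_div_geom hc ht, e]
  have := mul_le_mul_of_nonneg_left h hc.le
  linarith

lemma four_mul_dDiv_eq_sum {n : ℕ} {p q : Fin n → ℝ} (hp : p ∈ ProbDist n)
    (hq : q ∈ ProbDist n) :
    4 * dDiv p q =
      ∑ i, 4 * ((p i + q i) / 2 - (√(p i) + √(q i)) / 2 * √((p i + q i) / 2)) := by
  rw [← Finset.mul_sum, Finset.sum_sub_distrib, ← Finset.sum_div, Finset.sum_add_distrib, hp.2,
    hq.2, dDiv]
  norm_num

theorem seven_measure_inequalities (n : ℕ) (hn : 2 ≤ n)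
    (p q : Fin n → ℝ) (hp : p ∈ ProbDist n) (hq : q ∈ ProbDist n) :
    (1 / 4) * triDelta p q ≤ jsDiv p q ∧
    jsDiv p q ≤ hellinger p q ∧
    hellinger p q ≤ 4 * dDiv p q ∧
    4 * dDiv p q ≤ (1 / 8) * jDiv p q ∧
    (1 / 8) * jDiv p q ≤ agDiv p q ∧
    agDiv p q ≤ (1 / 16) * psiDiv p q := by
  have hp0 := hp.1
  have hq0 := hq.1
  rw [four_mul_dDiv_eq_sum hp hq]
  simp only [triDelta, jsDiv, hellinger, jDiv, agDiv, psiDiv, ← Finset.sum_add_distrib,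
    Finset.mul_sum]
  exact ⟨Finset.sum_le_sum fun i _ ↦ triangular_le_jensenShannon (hp0 i) (hq0 i),
    Finset.sum_le_sum fun i _ ↦ jensenShannon_le_hellinger (hp0 i) (hq0 i),
    Finset.sum_le_sum fun i _ ↦ hellinger_le_four_mul_d (hp0 i) (hq0 i),
    Finset.sum_le_sum fun i _ ↦ four_mul_d_le_jDiv (hp0 i) (hq0 i),
    Finset.sum_le_sum fun i _ ↦ jDiv_le_agDiv (hp0 i) (hq0 i),
    Finset.sum_le_sum fun i _ ↦ agDiv_le_psiDiv (hp0 i) (hq0 i)⟩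
end

section
/- For every n ≥ 2 and all P, Q ∈ Γₙ, the following sequence of inequalities holds: h(P||Q) − (1/4)Δ(P||Q) ≤ (4/5)[4d(P||Q) − (1/4)Δ(P||Q)] ≤ 4[4d(P||Q) − h(P||Q)] ≤ (12/7)[4d(P||Q) − I(P||Q)] ≤ 3[h(P||Q) − I(P||Q)] ≤ T(P||Q) − h(P||Q) ≤ (4/3)[T(P||Q) − 4d(P||Q)] ≤ (1/4)[(1/16)Ψ(P||Q) − (1/4)Δ(P||Q)] ≤ (1/3)[(1/16)Ψ(P||Q) − h(P||Q)] ≤ (4/11)[(1/16)Ψ(P||Q) − 4d(P||Q)] ≤ (1/2)[(1/16)Ψ(P||Q) − T(P||Q)]. -/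
open Real BigOperators Finset

/-- A function with nonnegative derivative on `[a, b]` satisfies `f a ≤ f b`. -/
lemma le_of_hasDerivAt_nonneg {f f' : ℝ → ℝ} {a b : ℝ} (hab : a ≤ b)
    (hf : ∀ x ∈ Set.Icc a b, HasDerivAt f (f' x) x) (hf' : ∀ x ∈ Set.Icc a b, 0 ≤ f' x) :
    f a ≤ f b := by
  refine monotoneOn_of_deriv_nonneg (convex_Icc a b)
    (fun x hx => (hf x hx).continuousAt.continuousWithinAt)
    (fun x hx => (hf x (interior_subset hx)).differentiableAt.differentiableWithinAt)
    (fun x hx => ?_) (Set.left_mem_Icc.2 hab) (Set.right_mem_Icc.2 hab) hab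
  rw [(hf x (interior_subset hx)).deriv]
  exact hf' x (interior_subset hx)

/-- A function with nonpositive derivative on `[a, b]` satisfies `f b ≤ f a`. -/
lemma le_of_hasDerivAt_nonpos {f f' : ℝ → ℝ} {a b : ℝ} (hab : a ≤ b)
    (hf : ∀ x ∈ Set.Icc a b, HasDerivAt f (f' x) x) (hf' : ∀ x ∈ Set.Icc a b, f' x ≤ 0) :
    f b ≤ f a :=
  neg_le_neg_iff.1 <| le_of_hasDerivAt_nonneg (f := fun x => -f x) hab
    (fun x hx => (hf x hx).fun_neg) (fun x hx => neg_nonneg.2 (hf' x hx))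

/-- The logarithmic function `artanh (sin θ)`, a primitive of the secant. -/
noncomputable def gudInv (θ : ℝ) : ℝ := (log (1 + sin θ) - log (1 - sin θ)) / 2

/-- The Jensen–Shannon generator at the weights `1 ± sin θ`. -/
noncomputable def jsGen (θ : ℝ) : ℝ :=
  ((1 + sin θ) * log (1 + sin θ) + (1 - sin θ) * log (1 - sin θ)) / 2

lemma one_add_sin_pos {θ : ℝ} (h : 0 < cos θ) : 0 < 1 + sin θ := by
  nlinarith [sin_sq_add_cos_sq θ, neg_one_le_sin θ, sq_nonneg (1 + sin θ), pow_pos h 2]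

lemma one_sub_sin_pos {θ : ℝ} (h : 0 < cos θ) : 0 < 1 - sin θ := by
  nlinarith [sin_sq_add_cos_sq θ, sin_le_one θ, sq_nonneg (1 - sin θ), pow_pos h 2]

lemma hasDerivAt_gudInv {θ : ℝ} (h : 0 < cos θ) : HasDerivAt gudInv (1 / cos θ) θ := by
  have h₁ := one_add_sin_pos h
  have h₂ := one_sub_sin_pos h
  refine HasDerivAt.congr_deriv (((((hasDerivAt_sin θ).const_add 1).log h₁.ne').fun_sub
    (((hasDerivAt_sin θ).const_sub 1).log h₂.ne')).div_const 2) ?_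
  field_simp
  linear_combination 2 * sin_sq_add_cos_sq θ

lemma hasDerivAt_jsGen {θ : ℝ} (h : 0 < cos θ) :
    HasDerivAt jsGen (cos θ * gudInv θ) θ := by
  have h₁ := one_add_sin_pos h
  have h₂ := one_sub_sin_pos h
  have d₁ := (hasDerivAt_sin θ).const_add 1
  have d₂ := (hasDerivAt_sin θ).const_sub 1
  refine HasDerivAt.congr_deriv
    (((d₁.fun_mul (d₁.log h₁.ne')).fun_add (d₂.fun_mul (d₂.log h₂.ne'))).div_const 2) ?_
  unfold gudInv
  field_simp
  ring

lemma cos_pos_of_mem_Icc {θ x : ℝ} (hθ : θ < π / 2) (hx : x ∈ Set.Icc 0 θ) : 0 < cos x :=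
  cos_pos_of_mem_Ioo ⟨by linarith [hx.1, pi_pos], by linarith [hx.2]⟩

lemma cos_half_pos_of_mem_Icc {θ x : ℝ} (hθ : θ < π / 2) (hx : x ∈ Set.Icc 0 θ) :
    0 < cos (x / 2) :=
  cos_pos_of_mem_Ioo ⟨by linarith [hx.1, pi_pos], by linarith [hx.2, hx.1]⟩

lemma cos_eq_two_mul_cos_half_sq (x : ℝ) : cos x = 2 * cos (x / 2) ^ 2 - 1 := by
  rw [← cos_two_mul]; ring_nf

lemma sin_eq_two_mul_sin_half (x : ℝ) : sin x = 2 * sin (x / 2) * cos (x / 2) := by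
  rw [← sin_two_mul]; ring_nf

lemma hasDerivAt_cos_half (x : ℝ) :
    HasDerivAt (fun x => cos (x / 2)) (-sin (x / 2) * (1 / 2)) x :=
  ((hasDerivAt_id x).div_const 2).cos

lemma three_mul_gudInv_le {θ : ℝ} (h0 : 0 ≤ θ) (hθ : θ < π / 2) :
    3 * gudInv θ ≤ sin θ / cos θ * (7 - 4 / cos (θ / 2)) := by
  have key := le_of_hasDerivAt_nonneg
    (f := fun x => sin x / cos x * (7 - 4 / cos (x / 2)) - 3 * gudInv x) h0
    (fun x hx => (((hasDerivAt_sin x).fun_div (hasDerivAt_cos x)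
      (cos_pos_of_mem_Icc hθ hx).ne').fun_mul
        (((hasDerivAt_const x (4 : ℝ)).fun_div (hasDerivAt_cos_half x)
          (cos_half_pos_of_mem_Icc hθ hx).ne').const_sub 7)).fun_sub
        ((hasDerivAt_gudInv (cos_pos_of_mem_Icc hθ hx)).const_mul 3)) ?_
  · have h : gudInv 0 = 0 := by simp [gudInv]
    simp only [sin_zero, h, zero_div, zero_mul, mul_zero, sub_zero] at key
    linarith
  intro x hx
  have hg := cos_pos_of_mem_Icc hθ hx
  have hc := cos_half_pos_of_mem_Icc hθ hx
  have e := cos_eq_two_mul_cos_half_sq x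
  have s := sin_eq_two_mul_sin_half x
  have : 0 ≤ (cos (x / 2) - 1) ^ 2 * (10 * cos (x / 2) + 8 * cos (x / 2) ^ 2) /
      (cos x ^ 2 * cos (x / 2)) := by positivity
  convert this using 1
  have hs := sin_sq (x / 2)
  generalize cos (x / 2) = c at *
  generalize sin (x / 2) = u at *
  rw [s]
  generalize cos x = g at *
  field_simp
  subst e
  linear_combination (4 * c ^ 2 * (7 * c - 4) - 4 * (2 * c ^ 2 - 1)) * hs

lemma four_mul_tan_le {θ : ℝ} (h0 : 0 ≤ θ) (hθ : θ < π / 2) :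
    4 * (sin θ / cos θ) ≤ sin θ / cos θ ^ 2 + 3 * gudInv θ := by
  have key := le_of_hasDerivAt_nonneg
    (f := fun x => sin x / cos x ^ 2 + 3 * gudInv x - 4 * (sin x / cos x)) h0
    (fun x hx => (((hasDerivAt_sin x).fun_div ((hasDerivAt_cos x).fun_pow 2)
      (pow_pos (cos_pos_of_mem_Icc hθ hx) 2).ne').fun_add
        ((hasDerivAt_gudInv (cos_pos_of_mem_Icc hθ hx)).const_mul 3)).fun_sub
        (((hasDerivAt_sin x).fun_div (hasDerivAt_cos x)
          (cos_pos_of_mem_Icc hθ hx).ne').const_mul 4)) ?_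
  · have h : gudInv 0 = 0 := by simp [gudInv]
    simp only [sin_zero, h, zero_div, mul_zero, add_zero, sub_zero] at key
    linarith
  intro x hx
  have hg := cos_pos_of_mem_Icc hθ hx
  have : 0 ≤ 2 * (cos x - 1) ^ 2 / cos x ^ 3 := by positivity
  convert this using 1
  field_simp
  norm_num
  have hS := sin_sq_add_cos_sq x
  generalize cos x = g at *
  generalize sin x = u at *
  linear_combination 2 * g * hS

lemma three_mul_jsGen_le {θ : ℝ} (h0 : 0 ≤ θ) (hθ : θ < π / 2) :
    3 * jsGen θ ≤ 7 * (1 - cos θ) - 16 * (1 - cos (θ / 2)) := by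
  have key := le_of_hasDerivAt_nonneg
    (f := fun x => 16 * cos (x / 2) - 7 * cos x - 3 * jsGen x) h0
    (fun x hx => (((hasDerivAt_cos_half x).const_mul 16).fun_sub
      ((hasDerivAt_cos x).const_mul 7)).fun_sub
        ((hasDerivAt_jsGen (cos_pos_of_mem_Icc hθ hx)).const_mul 3)) ?_
  · have h : jsGen 0 = 0 := by simp [jsGen]
    simp only [zero_div, cos_zero, h] at key
    linarith
  intro x hx
  have hg := cos_pos_of_mem_Icc hθ hx
  have hc := cos_half_pos_of_mem_Icc hθ hx
  have s := sin_eq_two_mul_sin_half x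
  have := mul_le_mul_of_nonneg_left (three_mul_gudInv_le hx.1 (hx.2.trans_lt hθ)) hg.le
  have e : cos x * (sin x / cos x * (7 - 4 / cos (x / 2))) = 7 * sin x - 8 * sin (x / 2) := by
    rw [s]; field_simp; ring
  linarith

lemma four_mul_one_sub_cos_le {θ : ℝ} (h0 : 0 ≤ θ) (hθ : θ < π / 2) :
    4 * (1 - cos θ) ≤ -log (cos θ) + 3 * jsGen θ := by
  have key := le_of_hasDerivAt_nonneg
    (f := fun x => 4 * cos x - log (cos x) + 3 * jsGen x) h0
    (fun x hx => (((hasDerivAt_cos x).const_mul 4).fun_sub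
      ((hasDerivAt_cos x).log (cos_pos_of_mem_Icc hθ hx).ne')).fun_add
        ((hasDerivAt_jsGen (cos_pos_of_mem_Icc hθ hx)).const_mul 3)) ?_
  · have h : jsGen 0 = 0 := by simp [jsGen]
    simp only [cos_zero, h, log_one] at key
    linarith
  intro x hx
  have hg := cos_pos_of_mem_Icc hθ hx
  have := mul_le_mul_of_nonneg_left (four_mul_tan_le hx.1 (hx.2.trans_lt hθ)) hg.le
  have e₁ : cos x * (4 * (sin x / cos x)) = 4 * sin x := by field_simp
  have e₂ : cos x * (sin x / cos x ^ 2 + 3 * gudInv x) =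
    sin x / cos x + 3 * (cos x * gudInv x) := by field_simp
  rw [e₁, e₂] at this
  rw [neg_div]
  linarith

lemma hasDerivAt_two_mul_sq_sub_one (x : ℝ) :
    HasDerivAt (fun x : ℝ => 2 * x ^ 2 - 1) (4 * x) x := by
  refine (((hasDerivAt_pow 2 x).const_mul 2).sub_const 1).congr_deriv ?_
  norm_num
  ring

lemma two_mul_sq_sub_one_pos {c x : ℝ} (hc : 0 < c) (hg : 0 < 2 * c ^ 2 - 1)
    (hx : x ∈ Set.Icc c 1) : 0 < 2 * x ^ 2 - 1 := by
  have := pow_le_pow_left₀ hc.le hx.1 2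
  linarith

lemma sixteen_mul_le_neg_log {c : ℝ} (hc : 0 < c) (hc1 : c ≤ 1) (hg : 0 < 2 * c ^ 2 - 1) :
    16 * (1 - c) ≤ -log (2 * c ^ 2 - 1) + 3 * (1 - (2 * c ^ 2 - 1)) := by
  have key := le_of_hasDerivAt_nonpos
    (f := fun x => -log (2 * x ^ 2 - 1) + 3 * (1 - (2 * x ^ 2 - 1)) - 16 * (1 - x)) hc1
    (fun x hx => (((hasDerivAt_two_mul_sq_sub_one x).log
      (two_mul_sq_sub_one_pos hc hg hx).ne').fun_neg.fun_add
        (((hasDerivAt_two_mul_sq_sub_one x).const_sub 1).const_mul 3)).fun_sub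
        (((hasDerivAt_id' x).const_sub 1).const_mul 16)) ?_
  · norm_num at key
    linarith
  intro x hx
  have hg' := two_mul_sq_sub_one_pos hc hg hx
  have hx0 : 0 < x := hc.trans_le hx.1
  have : 0 ≤ (x - 1) ^ 2 * (16 + 24 * x) / (2 * x ^ 2 - 1) := by positivity
  rw [← neg_nonneg]
  convert this using 1
  generalize hge : 2 * x ^ 2 - 1 = g at *
  field_simp
  rw [← hge]
  ring

lemma neg_log_le_four_mul {c : ℝ} (hc : 0 < c) (hc1 : c ≤ 1) (hg : 0 < 2 * c ^ 2 - 1) :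
    4 / 3 * -log (2 * c ^ 2 - 1) ≤ 16 / 3 * (1 - c) +
      1 / 8 * (1 / (2 * c ^ 2 - 1) ^ 2 - 2 + (2 * c ^ 2 - 1) ^ 2) := by
  have key := le_of_hasDerivAt_nonpos
    (f := fun x => 16 / 3 * (1 - x) + 1 / 8 * (1 / (2 * x ^ 2 - 1) ^ 2 - 2 + (2 * x ^ 2 - 1) ^ 2)
      + 4 / 3 * log (2 * x ^ 2 - 1)) hc1
    (fun x hx => ((((hasDerivAt_id' x).const_sub 1).const_mul (16 / 3)).fun_add
      (((((hasDerivAt_const x (1 : ℝ)).fun_div ((hasDerivAt_two_mul_sq_sub_one x).fun_pow 2)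
        (pow_pos (two_mul_sq_sub_one_pos hc hg hx) 2).ne').sub_const 2).fun_add
        ((hasDerivAt_two_mul_sq_sub_one x).fun_pow 2)).const_mul (1 / 8))).fun_add
        (((hasDerivAt_two_mul_sq_sub_one x).log
          (two_mul_sq_sub_one_pos hc hg hx).ne').const_mul (4 / 3))) ?_
  · norm_num at key
    norm_num
    linarith
  intro x hx
  have hg' := two_mul_sq_sub_one_pos hc hg hx
  have hx0 : 0 < x := hc.trans_le hx.1
  have hu : x ^ 2 ≤ 1 := pow_le_one₀ hx0.le hx.2
  have h₁ : 0 ≤ -4 + 4 * x ^ 2 + 32 * (x ^ 2) ^ 2 - 24 * (x ^ 2) ^ 3 := by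
    generalize x ^ 2 = u at *
    nlinarith [mul_nonneg hg'.le (sub_nonneg.2 hu),
      mul_nonneg (mul_nonneg hg'.le (sub_nonneg.2 hu)) (by linarith : 0 ≤ u)]
  have h₂ : 0 ≤ -12 + 42 * x ^ 2 - 12 * (x ^ 2) ^ 2 - 12 * (x ^ 2) ^ 3 := by
    generalize x ^ 2 = u at *
    nlinarith [mul_nonneg hg'.le (sub_nonneg.2 hu),
      mul_nonneg (mul_nonneg hg'.le (sub_nonneg.2 hu)) (by linarith : 0 ≤ u)]
  have : 0 ≤ 4 / 3 * ((x - 1) ^ 2 * ((-4 + 4 * x ^ 2 + 32 * (x ^ 2) ^ 2 - 24 * (x ^ 2) ^ 3) +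
      x * (-12 + 42 * x ^ 2 - 12 * (x ^ 2) ^ 2 - 12 * (x ^ 2) ^ 3))) / (2 * x ^ 2 - 1) ^ 3 := by
    positivity
  rw [← neg_nonneg]
  convert this using 1
  generalize hge : 2 * x ^ 2 - 1 = g at *
  field_simp
  rw [← hge]
  ring

lemma eleven_mul_neg_log_le {c : ℝ} (hc : 0 < c) (hc1 : c ≤ 1) (hg : 0 < 2 * c ^ 2 - 1) :
    11 * -log (2 * c ^ 2 - 1) ≤ 3 / 2 * (1 / (2 * c ^ 2 - 1) ^ 2 - 1) + 32 * (1 - c) := by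
  have key := le_of_hasDerivAt_nonpos
    (f := fun x => 3 / 2 * (1 / (2 * x ^ 2 - 1) ^ 2 - 1) + 32 * (1 - x)
      + 11 * log (2 * x ^ 2 - 1)) hc1
    (fun x hx => (((((hasDerivAt_const x (1 : ℝ)).fun_div
        ((hasDerivAt_two_mul_sq_sub_one x).fun_pow 2)
        (pow_pos (two_mul_sq_sub_one_pos hc hg hx) 2).ne').sub_const 1).const_mul (3 / 2)).fun_add
        (((hasDerivAt_id' x).const_sub 1).const_mul 32)).fun_add
        (((hasDerivAt_two_mul_sq_sub_one x).log
          (two_mul_sq_sub_one_pos hc hg hx).ne').const_mul 11)) ?_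
  · norm_num at key
    norm_num
    linarith
  intro x hx
  have hg' := two_mul_sq_sub_one_pos hc hg hx
  have hx0 : 0 < x := hc.trans_le hx.1
  have h₁ : 0 ≤ -8 + 8 * x ^ 2 + 64 * (x ^ 2) ^ 2 := by nlinarith
  have h₂ : 0 ≤ -24 + 84 * x ^ 2 := by linarith
  have : 0 ≤ 4 * ((x - 1) ^ 2 * ((-8 + 8 * x ^ 2 + 64 * (x ^ 2) ^ 2) +
      x * (-24 + 84 * x ^ 2))) / (2 * x ^ 2 - 1) ^ 3 := by
    positivity
  rw [← neg_nonneg]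
  convert this using 1
  generalize hge : 2 * x ^ 2 - 1 = g at *
  field_simp
  rw [← hge]
  ring

lemma jsGen_abs (θ : ℝ) : jsGen |θ| = jsGen θ := by
  rcases abs_choice θ with h | h <;> rw [h]
  simp only [jsGen, sin_neg, sub_neg_eq_add, ← sub_eq_add_neg]
  ring

/-- Two positive numbers are `A * (1 ± sin θ)` with `A` their mean; in these coordinates each
divergence generator is `A` times a function of `θ`. -/
lemma exists_angle {p q : ℝ} (hp : 0 < p) (hq : 0 < q) :
    ∃ A θ : ℝ, 0 < A ∧ |θ| < π / 2 ∧ (p + q) / 2 = A ∧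
      (p - q) ^ 2 / (p + q) = A * (2 * (1 - cos θ ^ 2)) ∧
      (√p - √q) ^ 2 = A * (2 * (1 - cos θ)) ∧
      p * log (2 * p / (p + q)) + q * log (2 * q / (p + q)) = A * (2 * jsGen θ) ∧
      (p + q) / 2 * log ((p + q) / (2 * √(p * q))) = A * -log (cos θ) ∧
      (p - q) ^ 2 * (p + q) / (p * q) = A * (8 * (1 / cos θ ^ 2 - 1)) ∧
      (√p + √q) / 2 * √((p + q) / 2) = A * cos (θ / 2) := by
  have hpq : 0 < p + q := add_pos hp hq
  have hx₁ : -1 < (p - q) / (p + q) := by rw [lt_div_iff₀ hpq]; linarith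
  have hx₂ : (p - q) / (p + q) < 1 := by rw [div_lt_iff₀ hpq]; linarith
  have hsin : sin (arcsin ((p - q) / (p + q))) = (p - q) / (p + q) :=
    sin_arcsin hx₁.le hx₂.le
  have hθ₁ : -(π / 2) < arcsin ((p - q) / (p + q)) := neg_pi_div_two_lt_arcsin.2 hx₁
  have hθ₂ : arcsin ((p - q) / (p + q)) < π / 2 := arcsin_lt_pi_div_two.2 hx₂
  generalize arcsin ((p - q) / (p + q)) = θ at *
  have hA : 0 < (p + q) / 2 := by positivity
  have hpA : p = (p + q) / 2 * (1 + sin θ) := by rw [hsin]; field_simp; ring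
  have hqA : q = (p + q) / 2 * (1 - sin θ) := by rw [hsin]; field_simp; ring
  clear hsin hx₁ hx₂ hpq
  generalize (p + q) / 2 = A at *
  have hg : 0 < cos θ := cos_pos_of_mem_Ioo ⟨hθ₁, hθ₂⟩
  have hk : 0 < cos (θ / 2) := cos_pos_of_mem_Ioo ⟨by linarith, by linarith⟩
  have hgk := cos_eq_two_mul_cos_half_sq θ
  have hsk := sin_eq_two_mul_sin_half θ
  have hku := sin_sq_add_cos_sq (θ / 2)
  have hsq : sin θ ^ 2 = 1 - cos θ ^ 2 := by linarith [sin_sq_add_cos_sq θ]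
  have hu := abs_lt.1 (abs_lt_of_sq_lt_sq (by linarith : sin (θ / 2) ^ 2 < cos (θ / 2) ^ 2) hk.le)
  have hrp : √p = √A * (cos (θ / 2) + sin (θ / 2)) := by
    rw [hpA, sqrt_mul hA.le, hsk,
      show 1 + 2 * sin (θ / 2) * cos (θ / 2) = (cos (θ / 2) + sin (θ / 2)) ^ 2 by
        linear_combination -hku, sqrt_sq (by linarith [hu.1])]
  have hrq : √q = √A * (cos (θ / 2) - sin (θ / 2)) := by
    rw [hqA, sqrt_mul hA.le, hsk,
      show 1 - 2 * sin (θ / 2) * cos (θ / 2) = (cos (θ / 2) - sin (θ / 2)) ^ 2 by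
        linear_combination -hku, sqrt_sq (by linarith [hu.2])]
  have hrA : √A ^ 2 = A := sq_sqrt hA.le
  have hsum : p + q = 2 * A := by rw [hpA, hqA]; ring
  have hprod : p * q = (A * cos θ) ^ 2 := by
    rw [hpA, hqA]; linear_combination -A ^ 2 * hsq
  have hdiff : (p - q) ^ 2 = 4 * A ^ 2 * (1 - cos θ ^ 2) := by
    rw [hpA, hqA]; linear_combination 4 * A ^ 2 * hsq
  refine ⟨A, θ, hA, abs_lt.2 ⟨hθ₁, hθ₂⟩, rfl, ?_, ?_, ?_, ?_, ?_, ?_⟩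
  · rw [hdiff, hsum]
    field_simp
    ring
  · rw [hrp, hrq]
    linear_combination 4 * sin (θ / 2) ^ 2 * hrA + 4 * A * hku + 2 * A * hgk
  · rw [hsum, show 2 * p / (2 * A) = 1 + sin θ by rw [hpA]; field_simp,
      show 2 * q / (2 * A) = 1 - sin θ by rw [hqA]; field_simp, jsGen]
    nth_rw 1 [hpA, hqA]
    ring
  · rw [hsum, hprod, sqrt_sq (by positivity), ← log_inv]
    congr 2
    field_simp
  · rw [hdiff, hsum, hprod]
    field_simp
    ring
  · rw [hrp, hrq]
    linear_combination cos (θ / 2) * hrA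

/-- The inequalities between the generators of the divergences. -/
lemma generator_inequalities {θ : ℝ} (hθ : |θ| < π / 2) :
    (1 - cos θ) - ((1 - cos θ ^ 2) / 2) ≤
      4 / 5 * (4 * (1 - cos (θ / 2)) - ((1 - cos θ ^ 2) / 2)) ∧
    4 / 5 * (4 * (1 - cos (θ / 2)) - ((1 - cos θ ^ 2) / 2)) ≤
      4 * (4 * (1 - cos (θ / 2)) - (1 - cos θ)) ∧
    4 * (4 * (1 - cos (θ / 2)) - (1 - cos θ)) ≤
      12 / 7 * (4 * (1 - cos (θ / 2)) - jsGen θ) ∧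
    12 / 7 * (4 * (1 - cos (θ / 2)) - jsGen θ) ≤
      3 * ((1 - cos θ) - jsGen θ) ∧
    3 * ((1 - cos θ) - jsGen θ) ≤
      -log (cos θ) - (1 - cos θ) ∧
    -log (cos θ) - (1 - cos θ) ≤
      4 / 3 * (-log (cos θ) - 4 * (1 - cos (θ / 2))) ∧
    4 / 3 * (-log (cos θ) - 4 * (1 - cos (θ / 2))) ≤
      1 / 4 * (((1 / cos θ ^ 2 - 1) / 2) - ((1 - cos θ ^ 2) / 2)) ∧
    1 / 4 * (((1 / cos θ ^ 2 - 1) / 2) - ((1 - cos θ ^ 2) / 2)) ≤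
      1 / 3 * (((1 / cos θ ^ 2 - 1) / 2) - (1 - cos θ)) ∧
    1 / 3 * (((1 / cos θ ^ 2 - 1) / 2) - (1 - cos θ)) ≤
      4 / 11 * (((1 / cos θ ^ 2 - 1) / 2) - 4 * (1 - cos (θ / 2))) ∧
    4 / 11 * (((1 / cos θ ^ 2 - 1) / 2) - 4 * (1 - cos (θ / 2))) ≤
      1 / 2 * (((1 / cos θ ^ 2 - 1) / 2) - -log (cos θ)) := by
  have hθ' := abs_lt.1 hθ
  have hg : 0 < cos θ := cos_pos_of_mem_Ioo hθ'
  have hc : 0 < cos (θ / 2) := cos_pos_of_mem_Ioo ⟨by linarith, by linarith⟩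
  have hc1 := cos_le_one (θ / 2)
  have hI := three_mul_jsGen_le (abs_nonneg θ) hθ
  have hJ := four_mul_one_sub_cos_le (abs_nonneg θ) hθ
  have habs : |θ| / 2 = |θ / 2| := by rw [abs_div, abs_two]
  rw [habs, jsGen_abs, cos_abs, cos_abs] at hI
  rw [jsGen_abs, cos_abs] at hJ
  have e := cos_eq_two_mul_cos_half_sq θ
  rw [e] at hg hI hJ ⊢
  have h₆ := sixteen_mul_le_neg_log hc hc1 hg
  have h₇ := neg_log_le_four_mul hc hc1 hg
  have h₁₀ := eleven_mul_neg_log_le hc hc1 hg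
  generalize cos (θ / 2) = c at *
  have hc1' : 0 ≤ 1 - c := sub_nonneg.2 hc1
  have hgc : 0 ≤ (2 * c ^ 2 - 1) * c := by positivity
  refine ⟨?_, ?_, by linarith, by linarith, by linarith, by linarith, by linarith, ?_, ?_,
    by linarith⟩
  · have : 0 ≤ (1 - c) ^ 3 * (6 / 5 + 2 / 5 * c) := by positivity
    linear_combination this
  · have : 0 ≤ (1 - c) ^ 3 * (24 / 5 + 8 / 5 * c) := by positivity
    linear_combination this
  · have h : 0 ≤ -1 - 3 * c + 8 * c ^ 3 + 9 * c ^ 4 + 3 * c ^ 5 := by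
      nlinarith [mul_nonneg hgc hc.le, mul_nonneg hgc (sq_nonneg c), pow_pos hc 5]
    have : 0 ≤ 2 / 3 * ((1 - c) ^ 3 * (-1 - 3 * c + 8 * c ^ 3 + 9 * c ^ 4 + 3 * c ^ 5)) /
        (2 * c ^ 2 - 1) ^ 2 := by positivity
    rw [← sub_nonneg]
    convert this using 1
    generalize hge : 2 * c ^ 2 - 1 = g at *
    field_simp
    rw [← hge]
    ring
  · have h : 0 ≤ -13 - 15 * c + 36 * c ^ 2 + 44 * c ^ 3 := by nlinarith
    have : 0 ≤ 2 / 33 * ((1 - c) ^ 3 * (-13 - 15 * c + 36 * c ^ 2 + 44 * c ^ 3)) /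
        (2 * c ^ 2 - 1) ^ 2 := by positivity
    rw [← sub_nonneg]
    convert this using 1
    generalize hge : 2 * c ^ 2 - 1 = g at *
    field_simp
    rw [← hge]
    ring

theorem difference_divergence_sequence (n : ℕ) (hn : 2 ≤ n)
    (p q : Fin n → ℝ) (hp : p ∈ ProbDist n) (hq : q ∈ ProbDist n) :
    hellinger p q - (1 / 4) * triDelta p q ≤
      (4 / 5) * (4 * dDiv p q - (1 / 4) * triDelta p q) ∧
    (4 / 5) * (4 * dDiv p q - (1 / 4) * triDelta p q) ≤
      4 * (4 * dDiv p q - hellinger p q) ∧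
    4 * (4 * dDiv p q - hellinger p q) ≤
      (12 / 7) * (4 * dDiv p q - jsDiv p q) ∧
    (12 / 7) * (4 * dDiv p q - jsDiv p q) ≤
      3 * (hellinger p q - jsDiv p q) ∧
    3 * (hellinger p q - jsDiv p q) ≤
      agDiv p q - hellinger p q ∧
    agDiv p q - hellinger p q ≤
      (4 / 3) * (agDiv p q - 4 * dDiv p q) ∧
    (4 / 3) * (agDiv p q - 4 * dDiv p q) ≤
      (1 / 4) * ((1 / 16) * psiDiv p q - (1 / 4) * triDelta p q) ∧
    (1 / 4) * ((1 / 16) * psiDiv p q - (1 / 4) * triDelta p q) ≤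
      (1 / 3) * ((1 / 16) * psiDiv p q - hellinger p q) ∧
    (1 / 3) * ((1 / 16) * psiDiv p q - hellinger p q) ≤
      (4 / 11) * ((1 / 16) * psiDiv p q - 4 * dDiv p q) ∧
    (4 / 11) * ((1 / 16) * psiDiv p q - 4 * dDiv p q) ≤
      (1 / 2) * ((1 / 16) * psiDiv p q - agDiv p q) := by
  choose A θ hA hθ hmean hΔ hh hI hT hΨ hd using fun i => exists_angle (hp.1 i) (hq.1 i)
  have hA1 : ∑ i, A i = 1 := by
    simp only [← hmean, ← Finset.sum_div, Finset.sum_add_distrib, hp.2, hq.2]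
    norm_num
  have eΔ : 1 / 4 * triDelta p q = ∑ i, A i * ((1 - cos (θ i) ^ 2) / 2) := by
    rw [triDelta, Finset.mul_sum]
    exact Finset.sum_congr rfl fun i _ => by rw [hΔ]; ring
  have eh : hellinger p q = ∑ i, A i * (1 - cos (θ i)) := by
    rw [hellinger, Finset.mul_sum]
    exact Finset.sum_congr rfl fun i _ => by rw [hh]; ring
  have eI : jsDiv p q = ∑ i, A i * jsGen (θ i) := by
    rw [jsDiv, ← Finset.sum_add_distrib, Finset.mul_sum]
    exact Finset.sum_congr rfl fun i _ => by rw [hI]; ring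
  have eT : agDiv p q = ∑ i, A i * -log (cos (θ i)) :=
    Finset.sum_congr rfl fun i _ => hT i
  have eΨ : 1 / 16 * psiDiv p q = ∑ i, A i * ((1 / cos (θ i) ^ 2 - 1) / 2) := by
    rw [psiDiv, Finset.mul_sum]
    exact Finset.sum_congr rfl fun i _ => by rw [hΨ]; ring
  have ed : 4 * dDiv p q = ∑ i, A i * (4 * (1 - cos (θ i / 2))) := by
    rw [dDiv]
    nth_rw 1 [← hA1]
    rw [← Finset.sum_sub_distrib, Finset.mul_sum]
    exact Finset.sum_congr rfl fun i _ => by rw [hd]; ring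
  simp only [eΔ, eh, eI, eT, eΨ, ed]
  choose k₁ k₂ k₃ k₄ k₅ k₆ k₇ k₈ k₉ k₁₀ using fun i => generator_inequalities (hθ i)
  simp only [Finset.mul_sum, ← Finset.sum_sub_distrib]
  have scale {x y : Fin n → ℝ} (h : ∀ i, x i ≤ y i) (i : Fin n) : A i * x i ≤ A i * y i :=
    mul_le_mul_of_nonneg_left (h i) (hA i).le
  refine ⟨?_, ?_, ?_, ?_, ?_, ?_, ?_, ?_, ?_, ?_⟩ <;> refine Finset.sum_le_sum fun i _ => ?_
  · linear_combination scale k₁ i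
  · linear_combination scale k₂ i
  · linear_combination scale k₃ i
  · linear_combination scale k₄ i
  · linear_combination scale k₅ i
  · linear_combination scale k₆ i
  · linear_combination scale k₇ i
  · linear_combination scale k₈ i
  · linear_combination scale k₉ i
  · linear_combination scale k₁₀ i
end

section
/- For every n ≥ 2 and all P, Q ∈ Γₙ, one has h(P||Q) − (1/4)Δ(P||Q) ≤ (4/5)[4d(P||Q) − (1/4)Δ(P||Q)]. -/
open Real BigOperators Finset

/-- The inequality between the generating functions of both sides, with `x = a ^ 2`, `y = b ^ 2`
and `s` the quadratic mean of `a` and `b`. -/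
lemma generator_le_of_quadratic_mean {a b s : ℝ} (ha : 0 < a) (hb : 0 < b) (hs : 0 < s)
    (hsq : s ^ 2 = (a ^ 2 + b ^ 2) / 2) :
    (1 / 2) * (a - b) ^ 2 - (1 / 4) * ((a ^ 2 - b ^ 2) ^ 2 / (a ^ 2 + b ^ 2)) ≤
      (4 / 5) * (4 * ((a ^ 2 + b ^ 2) / 2 - (a + b) / 2 * s)
        - (1 / 4) * ((a ^ 2 - b ^ 2) ^ 2 / (a ^ 2 + b ^ 2))) := by
  have hm : a + b ≤ 2 * s := by
    refine abs_le_of_sq_le_sq' ?_ (by positivity) |>.2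
    nlinarith [sq_nonneg (a - b)]
  have hslack : 0 ≤ (2 * s - (a + b)) ^ 3 * ((a + b) + 6 * s) / (40 * s ^ 2) := by
    have : 0 ≤ 2 * s - (a + b) := sub_nonneg.2 hm
    positivity
  have hsum : a ^ 2 + b ^ 2 = 2 * s ^ 2 := by linarith
  have hdiff : (a - b) ^ 2 = 4 * s ^ 2 - (a + b) ^ 2 := by linarith
  have hprod : (a ^ 2 - b ^ 2) ^ 2 = (a + b) ^ 2 * (4 * s ^ 2 - (a + b) ^ 2) := by
    rw [← hdiff]; ring
  rw [← sub_nonneg]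
  convert hslack using 1
  rw [hprod, hdiff, hsum]
  field_simp
  ring

lemma hellinger_generator_le {x y : ℝ} (hx : 0 < x) (hy : 0 < y) :
    (1 / 2) * (√x - √y) ^ 2 - (1 / 4) * ((x - y) ^ 2 / (x + y)) ≤
      (4 / 5) * (4 * ((x + y) / 2 - (√x + √y) / 2 * √((x + y) / 2))
        - (1 / 4) * ((x - y) ^ 2 / (x + y))) := by
  have h := generator_le_of_quadratic_mean (s := √((x + y) / 2)) (sqrt_pos.2 hx) (sqrt_pos.2 hy)
    (by positivity) (by rw [sq_sqrt hx.le, sq_sqrt hy.le, sq_sqrt (by positivity)])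
  rwa [sq_sqrt hx.le, sq_sqrt hy.le] at h

lemma dDiv_eq_sum {n : ℕ} {p q : Fin n → ℝ} (hp : p ∈ ProbDist n) (hq : q ∈ ProbDist n) :
    dDiv p q = ∑ i, ((p i + q i) / 2 - (√(p i) + √(q i)) / 2 * √((p i + q i) / 2)) := by
  rw [sum_sub_distrib, ← sum_div, sum_add_distrib, hp.2, hq.2, dDiv]
  norm_num

theorem D_hDelta_le_D_dDelta (n : ℕ) (hn : 2 ≤ n)
    (p q : Fin n → ℝ) (hp : p ∈ ProbDist n) (hq : q ∈ ProbDist n) :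
    hellinger p q - (1 / 4) * triDelta p q ≤
      (4 / 5) * (4 * dDiv p q - (1 / 4) * triDelta p q) := by
  rw [dDiv_eq_sum hp hq, hellinger, triDelta]
  simp only [mul_sum, ← sum_sub_distrib]
  exact sum_le_sum fun i _ => hellinger_generator_le (hp.1 i) (hq.1 i)
end

section
/- For every n ≥ 2 and all P, Q ∈ Γₙ, one has 4d(P||Q) − (1/4)Δ(P||Q) ≤ 5[4d(P||Q) − h(P||Q)]. -/
open Real BigOperators Finset

/-- Homogeneous pointwise inequality, with `m` the quadratic mean of `a` and `b`. -/
lemma five_halves_sq_sub_le {a b m : ℝ} (ha : 0 < a) (hb : 0 < b) (hm : 0 < m)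
    (h : a ^ 2 + b ^ 2 = 2 * m ^ 2) :
    5 / 2 * (a - b) ^ 2 ≤
      16 * (m ^ 2 - (a + b) / 2 * m) + 1 / 4 * ((a ^ 2 - b ^ 2) ^ 2 / (a ^ 2 + b ^ 2)) := by
  have hs : a + b ≤ 2 * m := by
    refine (abs_le_of_sq_le_sq' ?_ (by positivity)).2
    nlinarith [sq_nonneg (a - b)]
  have hd : (a - b) ^ 2 = 4 * m ^ 2 - (a + b) ^ 2 := by linear_combination 2 * h
  have hd' : (a ^ 2 - b ^ 2) ^ 2 = (a + b) ^ 2 * (4 * m ^ 2 - (a + b) ^ 2) := by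
    rw [← hd]; ring
  rw [hd', hd, h]
  have key : 16 * (m ^ 2 - (a + b) / 2 * m)
      + 1 / 4 * ((a + b) ^ 2 * (4 * m ^ 2 - (a + b) ^ 2) / (2 * m ^ 2))
      - 5 / 2 * (4 * m ^ 2 - (a + b) ^ 2)
      = (2 * m - (a + b)) * (2 * m - (a + b)) ^ 2 * (a + b + 6 * m) / (8 * m ^ 2) := by
    field_simp
    ring
  have hnonneg : 0 ≤ (2 * m - (a + b)) * (2 * m - (a + b)) ^ 2 * (a + b + 6 * m) / (8 * m ^ 2) := by
    have := sub_nonneg.2 hs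
    positivity
  linarith

theorem D_dDelta_le_D_dh (n : ℕ) (hn : 2 ≤ n)
    (p q : Fin n → ℝ) (hp : p ∈ ProbDist n) (hq : q ∈ ProbDist n) :
    4 * dDiv p q - (1 / 4) * triDelta p q ≤
      5 * (4 * dDiv p q - hellinger p q) := by
  obtain ⟨hp0, hp1⟩ := hp
  obtain ⟨hq0, hq1⟩ := hq
  have hd : dDiv p q = ∑ i, ((p i + q i) / 2 -
      (√(p i) + √(q i)) / 2 * √((p i + q i) / 2)) := by
    rw [dDiv, Finset.sum_sub_distrib, ← Finset.sum_div, Finset.sum_add_distrib, hp1, hq1]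
    norm_num
  have hsum : 5 / 2 * ∑ i, (√(p i) - √(q i)) ^ 2 ≤
      16 * dDiv p q + 1 / 4 * triDelta p q := by
    rw [hd, triDelta, Finset.mul_sum, Finset.mul_sum, Finset.mul_sum, ← Finset.sum_add_distrib]
    refine Finset.sum_le_sum fun i _ => ?_
    have hpi := hp0 i
    have hqi := hq0 i
    have hm : √((p i + q i) / 2) ^ 2 = (p i + q i) / 2 := Real.sq_sqrt (by positivity)
    have := five_halves_sq_sub_le (Real.sqrt_pos.2 hpi) (Real.sqrt_pos.2 hqi)
      (Real.sqrt_pos.2 (show 0 < (p i + q i) / 2 by positivity))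
      (by rw [hm, Real.sq_sqrt hpi.le, Real.sq_sqrt hqi.le]; ring)
    rwa [hm, Real.sq_sqrt hpi.le, Real.sq_sqrt hqi.le] at this
  rw [hellinger]
  linarith
end

section
/- For every n ≥ 2 and all P, Q ∈ Γₙ, one has 4d(P||Q) − h(P||Q) ≤ (3/7)[4d(P||Q) − I(P||Q)]. -/
open Real BigOperators Finset

lemma sin_lt_cos_of_lt_pi_div_four {x : ℝ} (h0 : 0 ≤ x) (h1 : x < π / 4) :
    Real.sin x < Real.cos x := by
  have hpi := Real.pi_pos
  have hs : Real.sin x < Real.sin (π / 4) :=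
    Real.sin_lt_sin_of_lt_of_le_pi_div_two (by linarith) (by linarith) h1
  have hc : Real.cos (π / 4) < Real.cos x :=
    Real.cos_lt_cos_of_nonneg_of_le_pi h0 (by linarith) h1
  rw [Real.sin_pi_div_four] at hs
  rw [Real.cos_pi_div_four] at hc
  exact hs.trans hc

lemma sin_nonneg_of_lt_pi_div_four {x : ℝ} (h0 : 0 ≤ x) (h1 : x < π / 4) :
    0 ≤ Real.sin x :=
  Real.sin_nonneg_of_nonneg_of_le_pi h0 (by linarith [Real.pi_pos])

/-- The bound on the difference of logarithms is the derivative condition for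
`half_angle_divergence_nonpos`. -/
lemma log_cos_add_sin_sub_le {x : ℝ} (h0 : 0 ≤ x) (h1 : x < π / 4) :
    6 * (Real.log (Real.cos x + Real.sin x) - Real.log (Real.cos x - Real.sin x)) ≤
      (28 * Real.sin x * Real.cos x - 16 * Real.sin x) /
        (Real.cos x ^ 2 - Real.sin x ^ 2) := by
  let H : ℝ → ℝ := fun y => (28 * Real.sin y * Real.cos y - 16 * Real.sin y) /
        (Real.cos y ^ 2 - Real.sin y ^ 2) -
      6 * (Real.log (Real.cos y + Real.sin y) - Real.log (Real.cos y - Real.sin y))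
  have hd : ∀ y ∈ Set.Ico 0 (π / 4), HasDerivAt H
      (8 * (Real.cos y - 1) ^ 2 * (4 * Real.cos y + 5) /
        (Real.cos y ^ 2 - Real.sin y ^ 2) ^ 2) y := by
    rintro y ⟨hy0, hy1⟩
    have hs := sin_nonneg_of_lt_pi_div_four hy0 hy1
    have hlt := sin_lt_cos_of_lt_pi_div_four hy0 hy1
    have hadd : Real.cos y + Real.sin y ≠ 0 := by linarith
    have hsub : Real.cos y - Real.sin y ≠ 0 := by linarith
    have hsq : Real.cos y ^ 2 - Real.sin y ^ 2 ≠ 0 := by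
      rw [sq_sub_sq]; exact mul_ne_zero hadd hsub
    have ds := Real.hasDerivAt_sin y
    have dc := Real.hasDerivAt_cos y
    have key := ((((ds.const_mul 28).mul dc).sub (ds.const_mul 16)).div
      ((dc.pow 2).sub (ds.pow 2)) hsq).sub
        ((((dc.add ds).log hadd).sub ((dc.sub ds).log hsub)).const_mul 6)
    refine key.congr_deriv ?_
    have hone := Real.sin_sq_add_cos_sq y
    simp only [Pi.add_apply, Pi.sub_apply, Pi.mul_apply, Pi.pow_apply]
    generalize Real.sin y = s at *
    generalize Real.cos y = c at *
    have hlog : (-s + c) / (c + s) - (-s - c) / (c - s) = 2 / (c ^ 2 - s ^ 2) := by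
      rw [sq_sub_sq]
      field_simp
      linear_combination 2 * hone
    rw [hlog]
    field_simp
    have hs2 : s ^ 2 = 1 - c ^ 2 := by linarith
    ring_nf
    simp only [show s ^ 4 = (s ^ 2) ^ 2 by ring, hs2]
    ring
  have hmono : MonotoneOn H (Set.Ico 0 (π / 4)) := by
    refine monotoneOn_of_deriv_nonneg (convex_Ico _ _)
      (fun y hy => (hd y hy).continuousAt.continuousWithinAt)
      (fun y hy => (hd y (interior_subset hy)).differentiableAt.differentiableWithinAt) ?_
    intro y hy
    have hy' := interior_subset hy
    rw [(hd y hy').deriv]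
    have hs := sin_nonneg_of_lt_pi_div_four hy'.1 hy'.2
    have hlt := sin_lt_cos_of_lt_pi_div_four hy'.1 hy'.2
    have hc : 0 < Real.cos y := by linarith
    positivity
  have hle : H 0 ≤ H x := hmono ⟨le_rfl, by positivity⟩ ⟨h0, h1⟩ h0
  have hzero : H 0 = 0 := by simp [H]
  simp only [hzero, H] at hle
  linarith

lemma half_angle_divergence_nonpos {x : ℝ} (h0 : 0 ≤ x) (h1 : x < π / 4) :
    16 * (1 - Real.cos x) - 14 * Real.sin x ^ 2 +
      3 * ((Real.cos x + Real.sin x) ^ 2 * Real.log (Real.cos x + Real.sin x) +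
        (Real.cos x - Real.sin x) ^ 2 * Real.log (Real.cos x - Real.sin x)) ≤ 0 := by
  let G : ℝ → ℝ := fun y => 16 * (1 - Real.cos y) - 14 * Real.sin y ^ 2 +
      3 * ((Real.cos y + Real.sin y) ^ 2 * Real.log (Real.cos y + Real.sin y) +
        (Real.cos y - Real.sin y) ^ 2 * Real.log (Real.cos y - Real.sin y))
  have hd : ∀ y ∈ Set.Ico 0 (π / 4), HasDerivAt G
      (16 * Real.sin y - 28 * Real.sin y * Real.cos y +
        (Real.cos y ^ 2 - Real.sin y ^ 2) * (6 *
          (Real.log (Real.cos y + Real.sin y) - Real.log (Real.cos y - Real.sin y)))) y := by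
    rintro y ⟨hy0, hy1⟩
    have hs := sin_nonneg_of_lt_pi_div_four hy0 hy1
    have hlt := sin_lt_cos_of_lt_pi_div_four hy0 hy1
    have hadd : Real.cos y + Real.sin y ≠ 0 := by linarith
    have hsub : Real.cos y - Real.sin y ≠ 0 := by linarith
    have ds := Real.hasDerivAt_sin y
    have dc := Real.hasDerivAt_cos y
    have key := (((dc.const_sub 1).const_mul 16).sub ((ds.pow 2).const_mul 14)).add
      (((((dc.add ds).pow 2).mul ((dc.add ds).log hadd)).add
        (((dc.sub ds).pow 2).mul ((dc.sub ds).log hsub))).const_mul 3)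
    refine key.congr_deriv ?_
    simp only [Pi.add_apply, Pi.sub_apply, Pi.pow_apply]
    field_simp
    push_cast
    ring
  have hanti : AntitoneOn G (Set.Ico 0 (π / 4)) := by
    refine antitoneOn_of_deriv_nonpos (convex_Ico _ _)
      (fun y hy => (hd y hy).continuousAt.continuousWithinAt)
      (fun y hy => (hd y (interior_subset hy)).differentiableAt.differentiableWithinAt) ?_
    intro y hy
    have hy' := interior_subset hy
    rw [(hd y hy').deriv]
    have hs := sin_nonneg_of_lt_pi_div_four hy'.1 hy'.2
    have hlt := sin_lt_cos_of_lt_pi_div_four hy'.1 hy'.2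
    have hpos : 0 < Real.cos y ^ 2 - Real.sin y ^ 2 := by nlinarith
    have hlog := log_cos_add_sin_sub_le hy'.1 hy'.2
    rw [le_div_iff₀ hpos] at hlog
    linarith
  have hle : G x ≤ G 0 := hanti ⟨le_rfl, by positivity⟩ ⟨h0, h1⟩ h0
  have hzero : G 0 = 0 := by simp [G]
  rwa [hzero] at hle

/-- Two positive reals in decreasing order, in rotated polar coordinates. -/
lemma exists_polar_cos_add_sin {a b : ℝ} (hb : 0 < b) (hba : b ≤ a) :
    ∃ r x : ℝ, 0 < r ∧ 0 ≤ x ∧ x < π / 4 ∧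
      a = r * (Real.cos x + Real.sin x) ∧ b = r * (Real.cos x - Real.sin x) := by
  set r := Real.sqrt ((a ^ 2 + b ^ 2) / 2)
  have hrpos : 0 < r := Real.sqrt_pos.2 (by positivity)
  have hr2 : r ^ 2 = (a ^ 2 + b ^ 2) / 2 := Real.sq_sqrt (by positivity)
  have ha : 0 < a := hb.trans_le hba
  have hs0 : 0 ≤ (a - b) / (2 * r) := div_nonneg (by linarith) (by positivity)
  have hc0 : 0 < (a + b) / (2 * r) := by positivity
  have hone : ((a - b) / (2 * r)) ^ 2 + ((a + b) / (2 * r)) ^ 2 = 1 := by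
    field_simp
    linear_combination -4 * hr2
  have hsin : Real.sin (Real.arcsin ((a - b) / (2 * r))) = (a - b) / (2 * r) :=
    Real.sin_arcsin (by linarith) (by nlinarith)
  have hcos : Real.cos (Real.arcsin ((a - b) / (2 * r))) = (a + b) / (2 * r) := by
    rw [Real.cos_arcsin, ← Real.sqrt_sq hc0.le]
    congr 1
    linarith
  refine ⟨r, Real.arcsin ((a - b) / (2 * r)), hrpos, Real.arcsin_nonneg.2 hs0, ?_, ?_, ?_⟩
  · by_contra! hge
    have hpi := Real.pi_pos
    have h1 : Real.sin (π / 4) ≤ (a - b) / (2 * r) := by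
      rw [← hsin]
      exact Real.sin_le_sin_of_le_of_le_pi_div_two (by linarith) (Real.arcsin_le_pi_div_two _) hge
    have h2 : (a + b) / (2 * r) ≤ Real.cos (π / 4) := by
      rw [← hcos]
      exact Real.cos_le_cos_of_nonneg_of_le_pi (by linarith)
        (by linarith [Real.arcsin_le_pi_div_two ((a - b) / (2 * r))]) hge
    rw [Real.sin_pi_div_four] at h1
    rw [Real.cos_pi_div_four] at h2
    have h3 := (div_le_div_iff_of_pos_right (by positivity : 0 < 2 * r)).1 (h2.trans h1)
    linarith
  · rw [hsin, hcos]
    field_simp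
    ring
  · rw [hsin, hcos]
    field_simp
    ring

lemma divergence_term_nonpos {p q : ℝ} (hp : 0 < p) (hq : 0 < q) :
    16 * ((p + q) / 2 - (Real.sqrt p + Real.sqrt q) / 2 * Real.sqrt ((p + q) / 2)) -
      7 / 2 * (Real.sqrt p - Real.sqrt q) ^ 2 +
      3 / 2 * (p * Real.log (2 * p / (p + q)) + q * Real.log (2 * q / (p + q))) ≤ 0 := by
  wlog hqp : q ≤ p generalizing p q
  · have h := this hq hp (le_of_not_ge hqp)
    rw [add_comm q p] at h
    linarith
  obtain ⟨r, x, hr, hx0, hx1, ha, hb⟩ :=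
    exists_polar_cos_add_sin (Real.sqrt_pos.2 hq) (Real.sqrt_le_sqrt hqp)
  have hmain := half_angle_divergence_nonpos hx0 hx1
  have hone := Real.sin_sq_add_cos_sq x
  have hpeq : p = r ^ 2 * (Real.cos x + Real.sin x) ^ 2 := by
    rw [← mul_pow, ← ha, Real.sq_sqrt hp.le]
  have hqeq : q = r ^ 2 * (Real.cos x - Real.sin x) ^ 2 := by
    rw [← mul_pow, ← hb, Real.sq_sqrt hq.le]
  have hsum : p + q = 2 * r ^ 2 := by
    rw [hpeq, hqeq]
    linear_combination 2 * r ^ 2 * hone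
  have hmean : Real.sqrt ((p + q) / 2) = r := by
    rw [hsum, mul_div_cancel_left₀ _ two_ne_zero, Real.sqrt_sq hr.le]
  have hlogp : Real.log (2 * p / (p + q)) = 2 * Real.log (Real.cos x + Real.sin x) := by
    rw [hsum, mul_div_mul_left _ _ two_ne_zero, hpeq, mul_div_cancel_left₀ _ (by positivity),
      Real.log_pow, Nat.cast_ofNat]
  have hlogq : Real.log (2 * q / (p + q)) = 2 * Real.log (Real.cos x - Real.sin x) := by
    rw [hsum, mul_div_mul_left _ _ two_ne_zero, hqeq, mul_div_cancel_left₀ _ (by positivity),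
      Real.log_pow, Nat.cast_ofNat]
  rw [hlogp, hlogq, hmean, ha, hb, hsum, hpeq, hqeq]
  have hscaled := mul_nonpos_of_nonneg_of_nonpos (sq_nonneg r) hmain
  linarith

theorem D_dh_le_D_dI (n : ℕ) (hn : 2 ≤ n)
    (p q : Fin n → ℝ) (hp : p ∈ ProbDist n) (hq : q ∈ ProbDist n) :
    4 * dDiv p q - hellinger p q ≤ (3 / 7) * (4 * dDiv p q - jsDiv p q) := by
  have hsum := Finset.sum_nonpos fun i (_ : i ∈ Finset.univ) =>
    divergence_term_nonpos (hp.1 i) (hq.1 i)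
  simp only [Finset.sum_add_distrib, Finset.sum_sub_distrib, ← Finset.mul_sum,
    ← Finset.sum_div] at hsum
  rw [hp.2, hq.2] at hsum
  unfold dDiv hellinger jsDiv
  linarith
end

section
/- For every n ≥ 2 and all P, Q ∈ Γₙ, one has 4d(P||Q) − I(P||Q) ≤ (7/4)[h(P||Q) − I(P||Q)]. -/
open Real BigOperators Finset

/-- The generator of `(7 / 4) h - 4 d - (3 / 4) I` at the pair `(1 + t, 1 - t)`. -/
noncomputable def divGap (t : ℝ) : ℝ :=
  (7 / 4) * (1 - √(1 + t) * √(1 - t)) - 4 + 2 * (√(1 + t) + √(1 - t)) -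
    (3 / 8) * ((1 + t) * log (1 + t) + (1 - t) * log (1 - t))

lemma hasDerivAt_sqrt_one_add {t : ℝ} (h : 0 < 1 + t) :
    HasDerivAt (fun t ↦ √(1 + t)) (1 / (2 * √(1 + t))) t :=
  ((hasDerivAt_id t).const_add 1).sqrt h.ne'

lemma hasDerivAt_sqrt_one_sub {t : ℝ} (h : 0 < 1 - t) :
    HasDerivAt (fun t ↦ √(1 - t)) (-1 / (2 * √(1 - t))) t :=
  ((hasDerivAt_id t).const_sub 1).sqrt h.ne'

lemma hasDerivAt_divGap {t : ℝ} (h₁ : 0 < 1 + t) (h₂ : 0 < 1 - t) :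
    HasDerivAt divGap ((7 / 8) * (√(1 + t) / √(1 - t) - √(1 - t) / √(1 + t)) +
      (1 / √(1 + t) - 1 / √(1 - t)) - (3 / 8) * (log (1 + t) - log (1 - t))) t := by
  have ha := hasDerivAt_sqrt_one_add h₁
  have hb := hasDerivAt_sqrt_one_sub h₂
  have hadd : HasDerivAt (fun t : ℝ ↦ 1 + t) 1 t := (hasDerivAt_id t).const_add 1
  have hsub : HasDerivAt (fun t : ℝ ↦ 1 - t) (-1) t := (hasDerivAt_id t).const_sub 1
  have ha₀ : √(1 + t) ≠ 0 := (sqrt_pos.2 h₁).ne'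
  have hb₀ : √(1 - t) ≠ 0 := (sqrt_pos.2 h₂).ne'
  have key := (((((ha.mul hb).const_sub 1).const_mul (7 / 4)).sub_const 4).add
    ((ha.add hb).const_mul 2)).sub (((hadd.mul (hadd.log h₁.ne')).add
      (hsub.mul (hsub.log h₂.ne'))).const_mul (3 / 8))
  refine key.congr_deriv ?_
  have h₁' := h₁.ne'
  have h₂' := h₂.ne'
  field_simp
  ring

lemma hasDerivAt_deriv_divGap {t : ℝ} (h₁ : 0 < 1 + t) (h₂ : 0 < 1 - t) :
    HasDerivAt (fun t ↦ (7 / 8) * (√(1 + t) / √(1 - t) - √(1 - t) / √(1 + t)) +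
      (1 / √(1 + t) - 1 / √(1 - t)) - (3 / 8) * (log (1 + t) - log (1 - t)))
      ((√(1 + t) + √(1 - t) - 2) ^ 2 * (2 * (√(1 + t) + √(1 - t)) + 5) /
        (8 * (√(1 + t) * √(1 - t)) ^ 3)) t := by
  have ha := hasDerivAt_sqrt_one_add h₁
  have hb := hasDerivAt_sqrt_one_sub h₂
  have hadd : HasDerivAt (fun t : ℝ ↦ 1 + t) 1 t := (hasDerivAt_id t).const_add 1
  have hsub : HasDerivAt (fun t : ℝ ↦ 1 - t) (-1) t := (hasDerivAt_id t).const_sub 1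
  have ha₀ : √(1 + t) ≠ 0 := (sqrt_pos.2 h₁).ne'
  have hb₀ : √(1 - t) ≠ 0 := (sqrt_pos.2 h₂).ne'
  have key := ((((ha.div hb hb₀).sub (hb.div ha ha₀)).const_mul (7 / 8)).add
    (((hasDerivAt_const t (1 : ℝ)).div ha ha₀).sub
      ((hasDerivAt_const t (1 : ℝ)).div hb hb₀))).sub
    (((hadd.log h₁.ne').sub (hsub.log h₂.ne')).const_mul (3 / 8))
  refine key.congr_deriv ?_
  have hsa : √(1 + t) ^ 2 = 1 + t := sq_sqrt h₁.le
  have hsb : √(1 - t) ^ 2 = 1 - t := sq_sqrt h₂.le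
  rw [← hsa, ← hsb]
  have hab : √(1 + t) ^ 2 + √(1 - t) ^ 2 = 2 := by rw [hsa, hsb]; ring
  simp only [sqrt_sq (sqrt_nonneg _)]
  generalize √(1 + t) = a at *
  generalize √(1 - t) = b at *
  field_simp
  linear_combination (7 * (a ^ 2 + b ^ 2) + 20 - 6 * (a * b) - 12 * (a + b)) * hab

lemma convexOn_divGap : ConvexOn ℝ (Set.Ioo (-1) 1) divGap := by
  have pos : ∀ t ∈ Set.Ioo (-1 : ℝ) 1, 0 < 1 + t ∧ 0 < 1 - t := fun t ht ↦
    ⟨by linarith [ht.1], by linarith [ht.2]⟩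
  refine convexOn_of_hasDerivWithinAt2_nonneg (convex_Ioo _ _)
    (fun t ht ↦ (hasDerivAt_divGap (pos t ht).1 (pos t ht).2).continuousAt.continuousWithinAt)
    (fun t ht ↦ ?_) (fun t ht ↦ ?_) (fun t ht ↦ ?_)
    (f' := fun t ↦ (7 / 8) * (√(1 + t) / √(1 - t) - √(1 - t) / √(1 + t)) +
      (1 / √(1 + t) - 1 / √(1 - t)) - (3 / 8) * (log (1 + t) - log (1 - t)))
    (f'' := fun t ↦ (√(1 + t) + √(1 - t) - 2) ^ 2 * (2 * (√(1 + t) + √(1 - t)) + 5) /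
        (8 * (√(1 + t) * √(1 - t)) ^ 3))
  all_goals rw [interior_Ioo] at *
  · exact (hasDerivAt_divGap (pos t ht).1 (pos t ht).2).hasDerivWithinAt
  · exact (hasDerivAt_deriv_divGap (pos t ht).1 (pos t ht).2).hasDerivWithinAt
  · positivity

lemma divGap_neg (t : ℝ) : divGap (-t) = divGap t := by
  simp only [divGap, sub_neg_eq_add, ← sub_eq_add_neg]
  ring

lemma divGap_nonneg {t : ℝ} (ht : t ∈ Set.Ioo (-1) 1) : 0 ≤ divGap t := by
  have ht' : -t ∈ Set.Ioo (-1 : ℝ) 1 := ⟨by linarith [ht.2], by linarith [ht.1]⟩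
  have h := convexOn_divGap.2 ht ht'
    (show (0 : ℝ) ≤ 1 / 2 by norm_num) (show (0 : ℝ) ≤ 1 / 2 by norm_num) (by norm_num)
  have h₀ : divGap 0 = 0 := by norm_num [divGap]
  simp only [smul_eq_mul, divGap_neg] at h
  rw [show 1 / 2 * t + 1 / 2 * -t = 0 by ring, h₀] at h
  linarith

lemma dDiv_summand_add_jsDiv_summand_le {x y : ℝ} (hx : 0 < x) (hy : 0 < y) :
    4 * ((x + y) / 2 - (√x + √y) / 2 * √((x + y) / 2)) +
      (3 / 8) * (x * log (2 * x / (x + y)) + y * log (2 * y / (x + y))) ≤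
      (7 / 8) * (√x - √y) ^ 2 := by
  obtain ⟨m, t, hm, ht, rfl, rfl⟩ : ∃ m t : ℝ, 0 < m ∧ t ∈ Set.Ioo (-1) 1 ∧
      x = m * (1 + t) ∧ y = m * (1 - t) := by
    have hxy : 0 < x + y := by positivity
    refine ⟨(x + y) / 2, (x - y) / (x + y), by positivity, ⟨?_, ?_⟩, ?_, ?_⟩
    · rw [lt_div_iff₀ hxy]; linarith
    · rw [div_lt_iff₀ hxy]; linarith
    · field_simp; ring
    · field_simp; ring
  have h₁ : 0 ≤ 1 + t := by linarith [ht.1]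
  have h₂ : 0 ≤ 1 - t := by linarith [ht.2]
  rw [show m * (1 + t) + m * (1 - t) = 2 * m by ring,
    show 2 * (m * (1 + t)) / (2 * m) = 1 + t by field_simp,
    show 2 * (m * (1 - t)) / (2 * m) = 1 - t by field_simp,
    show 2 * m / 2 = m by ring, sqrt_mul hm.le, sqrt_mul hm.le]
  have h := mul_nonneg hm.le (divGap_nonneg ht)
  have hsa := sq_sqrt h₁
  have hsb := sq_sqrt h₂
  have hsm := sq_sqrt hm.le
  have e₁ : (√m * √(1 + t) - √m * √(1 - t)) ^ 2 = m * (2 - 2 * (√(1 + t) * √(1 - t))) := by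
    linear_combination (√(1 + t) - √(1 - t)) ^ 2 * hsm + m * hsa + m * hsb
  have e₂ : (√m * √(1 + t) + √m * √(1 - t)) / 2 * √m = m * ((√(1 + t) + √(1 - t)) / 2) := by
    linear_combination (√(1 + t) + √(1 - t)) / 2 * hsm
  rw [e₁, e₂]
  unfold divGap at h
  linarith

theorem D_dI_le_D_hI (n : ℕ) (hn : 2 ≤ n)
    (p q : Fin n → ℝ) (hp : p ∈ ProbDist n) (hq : q ∈ ProbDist n) :
    4 * dDiv p q - jsDiv p q ≤ (7 / 4) * (hellinger p q - jsDiv p q) := by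
  have h := Finset.sum_le_sum fun i (_ : i ∈ Finset.univ) ↦
    dDiv_summand_add_jsDiv_summand_le (hp.1 i) (hq.1 i)
  simp only [Finset.sum_add_distrib, ← Finset.mul_sum, Finset.sum_sub_distrib,
    ← Finset.sum_div, hp.2, hq.2] at h
  unfold dDiv jsDiv hellinger
  linarith
end

section
/- For every n ≥ 2 and all P, Q ∈ Γₙ, one has T(P||Q) − h(P||Q) ≤ (4/3)[T(P||Q) − 4d(P||Q)]. -/
open Real BigOperators Finset

theorem log_two_mul_sq_sub_one_le {s : ℝ} (hs : 0 < s) (hs1 : s ≤ 1) (h : 1 < 2 * s ^ 2) :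
    Real.log (2 * s ^ 2 - 1) ≤ 16 * s - 10 - 6 * s ^ 2 := by
  have hpos : ∀ x ∈ Set.Icc s 1, 0 < 2 * x ^ 2 - 1 := fun x hx => by nlinarith [hx.1]
  have hd : ∀ x ∈ Set.Icc s 1, HasDerivAt
      (fun x : ℝ => 16 * x - 10 - 6 * x ^ 2 - Real.log (2 * x ^ 2 - 1))
      (16 - 12 * x - 4 * x / (2 * x ^ 2 - 1)) x := fun x hx => by
    have h1 : HasDerivAt (fun x : ℝ => 2 * x ^ 2 - 1) (4 * x) x := by
      refine (((hasDerivAt_pow 2 x).const_mul 2).sub_const 1).congr_deriv ?_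
      norm_num
      ring
    have h2 : HasDerivAt (fun x : ℝ => 16 * x - 10 - 6 * x ^ 2) (16 - 12 * x) x := by
      refine ((((hasDerivAt_id x).const_mul 16).sub_const 10).sub
        ((hasDerivAt_pow 2 x).const_mul 6)).congr_deriv ?_
      norm_num
      ring
    exact h2.sub (h1.log (hpos x hx).ne')
  have hanti : AntitoneOn
      (fun x : ℝ => 16 * x - 10 - 6 * x ^ 2 - Real.log (2 * x ^ 2 - 1)) (Set.Icc s 1) := by
    refine antitoneOn_of_hasDerivWithinAt_nonpos (convex_Icc s 1)
      (fun x hx => (hd x hx).continuousAt.continuousWithinAt)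
      (fun x hx => (hd x (interior_subset hx)).hasDerivWithinAt) fun x hx => ?_
    have hx := interior_subset hx
    have hg := hpos x hx
    have hfac : 16 - 12 * x - 4 * x / (2 * x ^ 2 - 1)
        = -(8 * (x - 1) ^ 2 * (3 * x + 2) / (2 * x ^ 2 - 1)) := by
      rw [← neg_div, eq_div_iff hg.ne', sub_mul, div_mul_cancel₀ _ hg.ne']
      ring
    have hx0 : 0 < x := hs.trans_le hx.1
    rw [hfac, neg_nonpos]
    positivity
  have := hanti ⟨le_rfl, hs1⟩ ⟨hs1, le_rfl⟩ hs1
  norm_num at this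
  linarith

theorem dDiv_term_le {x y : ℝ} (hx : 0 < x) (hy : 0 < y) :
    16 * ((x + y) / 2 - (√x + √y) / 2 * √((x + y) / 2)) ≤
      (x + y) / 2 * Real.log ((x + y) / (2 * √(x * y))) + 3 / 2 * (√x - √y) ^ 2 := by
  rw [Real.sqrt_mul hx.le]
  have ha := Real.sqrt_pos.2 hx
  have hb := Real.sqrt_pos.2 hy
  have hm : 0 < (x + y) / 2 := by positivity
  have hr := Real.sqrt_pos.2 hm
  have hxa := Real.sq_sqrt hx.le
  have hyb := Real.sq_sqrt hy.le
  have hr2 := Real.sq_sqrt hm.le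
  set a := √x
  set b := √y
  set r := √((x + y) / 2)
  have hsum : x + y = 2 * r ^ 2 := by linarith
  have hab : a ^ 2 + b ^ 2 = 2 * r ^ 2 := by linarith
  have hg : 2 * ((a + b) / (2 * r)) ^ 2 - 1 = a * b / r ^ 2 := by
    field_simp
    linarith
  have hle : (a + b) / (2 * r) ≤ 1 := by
    rw [div_le_one (by positivity)]
    nlinarith [sq_nonneg (a - b)]
  have hgpos : 0 < a * b / r ^ 2 := by positivity
  have key := log_two_mul_sq_sub_one_le (s := (a + b) / (2 * r)) (by positivity) hle
    (by linarith)
  have hlog : Real.log ((x + y) / (2 * (a * b))) = -Real.log (a * b / r ^ 2) := by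
    rw [← Real.log_inv, inv_div, hsum, mul_div_mul_left _ _ two_ne_zero]
  rw [hg] at key
  have hmul := mul_le_mul_of_nonneg_left key (sq_nonneg r)
  have hexp : r ^ 2 * (16 * ((a + b) / (2 * r)) - 10 - 6 * ((a + b) / (2 * r)) ^ 2)
      = 8 * (a + b) * r - 10 * r ^ 2 - 3 / 2 * (a + b) ^ 2 := by
    field_simp
    ring
  rw [hlog, hsum]
  nlinarith

theorem D_Th_le_D_Td (n : ℕ) (hn : 2 ≤ n)
    (p q : Fin n → ℝ) (hp : p ∈ ProbDist n) (hq : q ∈ ProbDist n) :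
    agDiv p q - hellinger p q ≤ (4 / 3) * (agDiv p q - 4 * dDiv p q) := by
  have hsum : ∑ i, (p i + q i) / 2 = 1 := by
    rw [← Finset.sum_div, Finset.sum_add_distrib, hp.2, hq.2]
    norm_num
  have key := Finset.sum_le_sum fun i (_ : i ∈ Finset.univ) => dDiv_term_le (hp.1 i) (hq.1 i)
  rw [← Finset.mul_sum, Finset.sum_sub_distrib, hsum, Finset.sum_add_distrib,
    ← Finset.mul_sum] at key
  unfold agDiv hellinger dDiv
  linarith
end

section
/- For every n ≥ 2 and all P, Q ∈ Γₙ, one has T(P||Q) − 4d(P||Q) ≤ (3/16)[(1/16)Ψ(P||Q) − (1/4)Δ(P||Q)]. -/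
open Real BigOperators Finset

theorem neg_log_le_rational {s : ℝ} (hs : 0 < s) (hs1 : s ≤ 1) :
    -Real.log s ≤ 3 / 32 * (1 - s ^ 2) ^ 2 / s ^ 2 + (1 - s) + (1 - s) ^ 2 / 8 := by
  have hderiv : ∀ x ∈ Set.Icc s 1, HasDerivAt
      (fun x : ℝ => 3 / 32 * (1 - x ^ 2) ^ 2 / x ^ 2 + (1 - x) + (1 - x) ^ 2 / 8 + Real.log x)
      ((x - 1) ^ 2 * (7 * x ^ 2 - 6 * x - 3) / (16 * x ^ 3)) x := by
    intro x hx
    have hx0 : x ≠ 0 := (hs.trans_le hx.1).ne'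
    have hid := hasDerivAt_id' x
    have h := (((((((hid.pow 2).const_sub 1).pow 2).const_mul (3 / 32)).div (hid.pow 2)
      (pow_ne_zero 2 hx0)).add (hid.const_sub 1)).add
      (((hid.const_sub 1).pow 2).div_const 8)).add (Real.hasDerivAt_log hx0)
    refine h.congr_deriv ?_
    simp only [Pi.pow_apply]
    field_simp
    ring
  have hanti := antitoneOn_of_deriv_nonpos (convex_Icc s 1)
    (fun x hx => (hderiv x hx).continuousAt.continuousWithinAt)
    (fun x hx => (hderiv x (interior_subset hx)).differentiableAt.differentiableWithinAt)
    (fun x hx => by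
      have hx' := interior_subset hx
      have hx0 : 0 < x := hs.trans_le hx'.1
      rw [(hderiv x hx').deriv]
      refine div_nonpos_of_nonpos_of_nonneg ?_ (by positivity)
      exact mul_nonpos_of_nonneg_of_nonpos (sq_nonneg _) (by nlinarith [hx'.2]))
  have h := hanti (Set.left_mem_Icc.2 hs1) (Set.right_mem_Icc.2 hs1) hs1
  norm_num at h
  linarith

theorem agDiv_term_sub_dDiv_term_le {p q : ℝ} (hp : 0 < p) (hq : 0 < q) :
    (p + q) / 2 * Real.log ((p + q) / (2 * √(p * q))) -
        4 * ((p + q) / 2 - (√p + √q) / 2 * √((p + q) / 2)) ≤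
      3 / 16 * (1 / 16 * ((p - q) ^ 2 * (p + q) / (p * q)) -
        1 / 4 * ((p - q) ^ 2 / (p + q))) := by
  set g := √(p * q) with hg
  have hg0 : 0 < g := Real.sqrt_pos.2 (mul_pos hp hq)
  have hg2 : g ^ 2 = p * q := Real.sq_sqrt (mul_pos hp hq).le
  obtain ⟨a, ha⟩ : ∃ a, a = (p + q) / 2 := ⟨_, rfl⟩
  have ha0 : 0 < a := by rw [ha]; positivity
  have hga : g ≤ a := by
    refine abs_le_of_sq_le_sq' ?_ ha0.le |>.2
    rw [hg2, ha]
    nlinarith [sq_nonneg (p - q)]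
  obtain ⟨s, hs⟩ : ∃ s, s = g / a := ⟨_, rfl⟩
  have hs0 : 0 < s := by rw [hs]; positivity
  have hs1 : s ≤ 1 := by rw [hs]; exact (div_le_one ha0).2 hga
  have hgs : g = a * s := by rw [hs]; field_simp
  have hpq : p + q = 2 * a := by rw [ha]; ring
  have hlog : Real.log ((p + q) / (2 * g)) = -Real.log s := by
    rw [← Real.log_inv, hs, hpq]
    congr 1
    field_simp
  have hroot : (√p + √q) / 2 * √((p + q) / 2) ≤ a * (1 - (1 - s) / 4 - (1 - s) ^ 2 / 32) := by
    refine abs_le_of_sq_le_sq' ?_ (mul_nonneg ha0.le (by nlinarith)) |>.2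
    have hsq : ((√p + √q) / 2 * √((p + q) / 2)) ^ 2 = a ^ 2 * ((1 + s) / 2) := by
      have hmul : √p * √q = a * s := by rw [← Real.sqrt_mul hp.le, ← hg, hgs]
      rw [mul_pow, Real.sq_sqrt (by positivity), ← ha]
      have : ((√p + √q) / 2) ^ 2 = (√p ^ 2 + √q ^ 2 + 2 * (√p * √q)) / 4 := by ring
      rw [this, Real.sq_sqrt hp.le, Real.sq_sqrt hq.le, hmul, hpq]
      ring
    rw [hsq, mul_pow]
    refine mul_le_mul_of_nonneg_left ?_ (sq_nonneg a)
    have : 0 ≤ (1 - s) ^ 3 * (1 / 64 + (1 - s) / 1024) :=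
      mul_nonneg (pow_nonneg (by linarith) 3) (by linarith)
    nlinarith
  have hright : 3 / 16 * (1 / 16 * ((p - q) ^ 2 * (p + q) / (p * q)) -
      1 / 4 * ((p - q) ^ 2 / (p + q))) = a * (3 / 32 * (1 - s ^ 2) ^ 2 / s ^ 2) := by
    have hdiff : (p - q) ^ 2 = 4 * a ^ 2 * (1 - s ^ 2) := by
      have : (p - q) ^ 2 = (p + q) ^ 2 - 4 * (p * q) := by ring
      rw [this, ← hg2, hgs, hpq]
      ring
    rw [hdiff, ← hg2, hgs, hpq]
    field_simp
    ring
  rw [hright, hlog, ← ha]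
  rw [← ha] at hroot
  nlinarith [mul_le_mul_of_nonneg_left (neg_log_le_rational hs0 hs1) ha0.le]

theorem D_Td_le_D_PsiDelta (n : ℕ) (hn : 2 ≤ n)
    (p q : Fin n → ℝ) (hp : p ∈ ProbDist n) (hq : q ∈ ProbDist n) :
    agDiv p q - 4 * dDiv p q ≤
      (3 / 16) * ((1 / 16) * psiDiv p q - (1 / 4) * triDelta p q) := by
  have hd : dDiv p q =
      ∑ i, ((p i + q i) / 2 - (√(p i) + √(q i)) / 2 * √((p i + q i) / 2)) := by
    rw [dDiv, Finset.sum_sub_distrib, ← Finset.sum_div, Finset.sum_add_distrib, hp.2, hq.2]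
    norm_num
  rw [hd, agDiv, psiDiv, triDelta]
  simp only [Finset.mul_sum, ← Finset.sum_sub_distrib]
  exact Finset.sum_le_sum fun i _ => agDiv_term_sub_dDiv_term_le (hp.1 i) (hq.1 i)
end

section
/- For every n ≥ 2 and all P, Q ∈ Γₙ, one has (1/16)Ψ(P||Q) − 4d(P||Q) ≤ (11/8)[(1/16)Ψ(P||Q) − T(P||Q)]. -/
open Real BigOperators Finset

/-- The one-variable inequality behind the termwise comparison, in the normalised variable
`s = (√p + √q) / (2 √((p + q) / 2))`, for which `2 * s ^ 2 - 1 = √(p q) / ((p + q) / 2)`. -/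
lemma generator_nonneg {s : ℝ} (hs0 : 0 < s) (hs : 0 < 2 * s ^ 2 - 1) (hs1 : s ≤ 1) :
    0 ≤ (3 / 16) * (((2 * s ^ 2 - 1) ^ 2)⁻¹ - 1) + 4 * (1 - s) +
      (11 / 8) * Real.log (2 * s ^ 2 - 1) := by
  have hpos : ∀ t ∈ Set.Icc s 1, 0 < 2 * t ^ 2 - 1 := fun t ht => by
    nlinarith [ht.1]
  have hderiv : ∀ t ∈ Set.Icc s 1, HasDerivAt
      (fun t : ℝ => (3 / 16) * (((2 * t ^ 2 - 1) ^ 2)⁻¹ - 1) + 4 * (1 - t) +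
        (11 / 8) * Real.log (2 * t ^ 2 - 1))
      (-((1 - t) ^ 2 * (2 * (16 * t ^ 4 + 21 * t ^ 3 + 2 * t ^ 2 - 6 * t - 2)) /
        (2 * t ^ 2 - 1) ^ 3)) t := by
    intro t ht
    have hg := (hpos t ht).ne'
    have hd : HasDerivAt (fun t : ℝ => 2 * t ^ 2 - 1) (4 * t) t := by
      refine (((hasDerivAt_pow 2 t).const_mul 2).sub_const 1).congr_deriv ?_
      norm_num
      ring
    have hinv := (((hd.fun_pow 2).fun_inv (pow_ne_zero 2 hg)).sub_const 1).const_mul (3 / 16)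
    have hlin := ((hasDerivAt_id' t).const_sub 1).const_mul 4
    have hlog := (hd.log hg).const_mul (11 / 8)
    refine ((hinv.add hlin).add hlog).congr_deriv ?_
    field_simp
    ring
  have hanti : AntitoneOn (fun t : ℝ => (3 / 16) * (((2 * t ^ 2 - 1) ^ 2)⁻¹ - 1) +
      4 * (1 - t) + (11 / 8) * Real.log (2 * t ^ 2 - 1)) (Set.Icc s 1) := by
    refine antitoneOn_of_deriv_nonpos (convex_Icc s 1)
      (fun t ht => (hderiv t ht).continuousAt.continuousWithinAt)
      (fun t ht => (hderiv t (interior_subset ht)).differentiableAt.differentiableWithinAt)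
      (fun t ht => ?_)
    have ht := interior_subset ht
    rw [(hderiv t ht).deriv, neg_nonpos]
    have hg := hpos t ht
    have ht0 : 0 < t := hs0.trans_le ht.1
    have ht7 : 7 / 10 < t := by nlinarith
    have hfactor : 0 ≤ 16 * t ^ 4 + 21 * t ^ 3 + 2 * t ^ 2 - 6 * t - 2 := by
      nlinarith [mul_pos ht0 hg, mul_pos hg hg]
    positivity
  simpa [show (2 : ℝ) - 1 = 1 by norm_num] using
    hanti (Set.left_mem_Icc.2 hs1) (Set.right_mem_Icc.2 hs1) hs1

/-- The termwise comparison of the generators of `Ψ`, `d` and `T`. -/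
lemma termwise_nonneg {x y : ℝ} (hx : 0 < x) (hy : 0 < y) :
    0 ≤ (3 / 128) * ((x - y) ^ 2 * (x + y) / (x * y)) +
      4 * ((x + y) / 2 - (√x + √y) / 2 * √((x + y) / 2)) -
      (11 / 8) * ((x + y) / 2 * Real.log ((x + y) / (2 * √(x * y)))) := by
  obtain ⟨a, ha, rfl⟩ : ∃ a, 0 < a ∧ x = a ^ 2 := ⟨√x, by positivity, (Real.sq_sqrt hx.le).symm⟩
  obtain ⟨b, hb, rfl⟩ : ∃ b, 0 < b ∧ y = b ^ 2 := ⟨√y, by positivity, (Real.sq_sqrt hy.le).symm⟩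
  have hc : 0 < √((a ^ 2 + b ^ 2) / 2) := by positivity
  have hcsq : √((a ^ 2 + b ^ 2) / 2) ^ 2 = (a ^ 2 + b ^ 2) / 2 := Real.sq_sqrt (by positivity)
  rw [← mul_pow, Real.sqrt_sq ha.le, Real.sqrt_sq hb.le, Real.sqrt_sq (mul_pos ha hb).le]
  generalize √((a ^ 2 + b ^ 2) / 2) = c at hc hcsq ⊢
  have hratio : 2 * ((a + b) / (2 * c)) ^ 2 - 1 = a * b / c ^ 2 := by
    field_simp
    linear_combination (-2) * hcsq
  have hle : (a + b) / (2 * c) ≤ 1 := by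
    rw [div_le_one (by positivity)]
    nlinarith [sq_nonneg (a - b)]
  have key := generator_nonneg (s := (a + b) / (2 * c)) (by positivity)
    (by rw [hratio]; positivity) hle
  rw [hratio] at key
  have hsum : a ^ 2 + b ^ 2 = 2 * c ^ 2 := by linarith
  have hlog : Real.log ((a ^ 2 + b ^ 2) / (2 * (a * b))) = -Real.log (a * b / c ^ 2) := by
    rw [← Real.log_inv, hsum]
    congr 1
    field_simp
  have hdiff : (a ^ 2 - b ^ 2) ^ 2 = 4 * c ^ 4 - 4 * (a * b) ^ 2 := by
    linear_combination (a ^ 2 + b ^ 2 + 2 * c ^ 2) * hsum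
  rw [hlog, hdiff, hsum]
  refine (mul_nonneg (sq_nonneg c) key).trans_eq ?_
  field_simp
  ring

theorem D_Psid_le_D_PsiT (n : ℕ) (hn : 2 ≤ n)
    (p q : Fin n → ℝ) (hp : p ∈ ProbDist n) (hq : q ∈ ProbDist n) :
    (1 / 16) * psiDiv p q - 4 * dDiv p q ≤
      (11 / 8) * ((1 / 16) * psiDiv p q - agDiv p q) := by
  have hsum := Finset.sum_nonneg fun i (_ : i ∈ Finset.univ) =>
    termwise_nonneg (hp.1 i) (hq.1 i)
  have hmean : ∑ i, (p i + q i) / 2 = 1 := by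
    rw [← Finset.sum_div, Finset.sum_add_distrib, hp.2, hq.2]
    norm_num
  rw [Finset.sum_sub_distrib, Finset.sum_add_distrib, ← Finset.mul_sum, ← Finset.mul_sum,
    ← Finset.mul_sum, Finset.sum_sub_distrib, hmean] at hsum
  unfold psiDiv dDiv agDiv
  linarith
end

section
/- For every n ≥ 2 and all P, Q ∈ Γₙ, one has (1/9)[T(P||Q) − 4d(P||Q)] ≤ (1/8)J(P||Q) − 4d(P||Q). -/
open Real BigOperators Finset

/-- The root mean square of `s` and `1`. -/
noncomputable def rms (s : ℝ) : ℝ := Real.sqrt ((s ^ 2 + 1) / 2)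

/-- The generating function of `9 J - 8 T - 256 d`, in the variable `s = √(p / q)`. -/
noncomputable def gap (s : ℝ) : ℝ :=
  18 * (s ^ 2 - 1) * Real.log s
    - 4 * (s ^ 2 + 1) * (Real.log (s ^ 2 + 1) - Real.log 2 - Real.log s)
    - 128 * (s ^ 2 + 1) + 128 * (s + 1) * rms s

/-- The derivative of `gap` at `s`, divided by `2 * s`. -/
noncomputable def gapSlope (s : ℝ) : ℝ :=
  22 * Real.log s - 4 * Real.log (s ^ 2 + 1) + 4 * Real.log 2 - 121 - 7 * (s ^ 2)⁻¹
    + 64 * (rms s / s) + 32 * ((s + 1) / rms s)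

lemma rms_pos (s : ℝ) : 0 < rms s := Real.sqrt_pos.mpr (by positivity)

lemma rms_sq (s : ℝ) : rms s ^ 2 = (s ^ 2 + 1) / 2 := Real.sq_sqrt (by positivity)

lemma rms_one : rms 1 = 1 := by norm_num [rms]

lemma hasDerivAt_rms (s : ℝ) : HasDerivAt rms (s / (2 * rms s)) s := by
  have h : HasDerivAt (fun x : ℝ => (x ^ 2 + 1) / 2) s s := by
    simpa using (((hasDerivAt_id s).pow 2).add_const 1).div_const 2
  exact h.sqrt (by positivity)

lemma hasDerivAt_sq_add_one (s : ℝ) : HasDerivAt (fun x : ℝ => x ^ 2 + 1) (2 * s) s := by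
  simpa using ((hasDerivAt_id s).pow 2).add_const 1

lemma hasDerivAt_gap {s : ℝ} (hs : 0 < s) : HasDerivAt gap (2 * s * gapSlope s) s := by
  have hw := rms_pos s
  have h1 := hasDerivAt_sq_add_one s
  have hl := Real.hasDerivAt_log hs.ne'
  have hm : HasDerivAt (fun x : ℝ => x ^ 2 - 1) (2 * s) s := by
    simpa using ((hasDerivAt_id s).pow 2).sub_const 1
  have h := ((((hm.const_mul 18).mul hl).sub
    ((h1.const_mul 4).mul (((h1.log (by positivity)).sub_const (Real.log 2)).sub hl))).sub
    (h1.const_mul 128)).add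
    ((((hasDerivAt_id s).add_const 1).const_mul 128).mul (hasDerivAt_rms s))
  refine h.congr_deriv ?_
  simp only [id, gapSlope, Pi.sub_apply]
  field_simp
  ring_nf

lemma sixteen_mul_le_mul_rms {s : ℝ} (hs : 0 < s) :
    16 * s * (s ^ 3 + 1) ≤ (7 * s ^ 4 + 18 * s ^ 2 + 7) * rms s := by
  have hw := rms_pos s
  refine le_of_pow_le_pow_left₀ two_ne_zero (by positivity) ?_
  rw [mul_pow _ (rms s), rms_sq]
  have h : 0 ≤ (s - 1) ^ 4 * (49 * s ^ 6 + 196 * s ^ 5 + 279 * s ^ 4 + 136 * s ^ 3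
      + 279 * s ^ 2 + 196 * s + 49) := by positivity
  linear_combination h / 2

lemma hasDerivAt_gapSlope {s : ℝ} (hs : 0 < s) :
    HasDerivAt gapSlope
      (2 * ((7 * s ^ 4 + 18 * s ^ 2 + 7) * rms s - 16 * s * (s ^ 3 + 1))
        / (s ^ 3 * (s ^ 2 + 1) * rms s)) s := by
  have hw := rms_pos s
  have hw2 := rms_sq s
  have hr := hasDerivAt_rms s
  have h1 := hasDerivAt_sq_add_one s
  have hid := hasDerivAt_id s
  have h := (((((((Real.hasDerivAt_log hs.ne').const_mul 22).sub
    ((h1.log (by positivity)).const_mul 4)).add_const (4 * Real.log 2)).sub_const 121).sub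
    (((hid.pow 2).inv (by simpa using hs.ne')).const_mul 7)).add
    ((hr.div hid hs.ne').const_mul 64)).add
    (((hid.add_const 1).div hr hw.ne').const_mul 32)
  refine h.congr_deriv ?_
  simp only [id, Pi.pow_apply]
  have e : s ^ 2 + 1 = 2 * rms s ^ 2 := by linarith
  rw [e]
  field_simp
  push_cast
  linear_combination (28 * rms s * s + 44 * rms s * s ^ 3
    - 128 * s ^ 2 * (rms s ^ 2 - s ^ 2 / 2 + 1 / 2)) * hw2

lemma monotoneOn_gapSlope : MonotoneOn gapSlope (Set.Ioi 0) := by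
  refine monotoneOn_of_deriv_nonneg (convex_Ioi 0)
    (fun s hs => (hasDerivAt_gapSlope hs).continuousAt.continuousWithinAt)
    (fun s hs => (hasDerivAt_gapSlope (interior_subset hs)).differentiableAt.differentiableWithinAt)
    fun s hs => ?_
  have hs : 0 < s := interior_subset hs
  have hw := rms_pos s
  rw [(hasDerivAt_gapSlope hs).deriv]
  have := sub_nonneg.mpr (sixteen_mul_le_mul_rms hs)
  positivity

lemma gapSlope_one : gapSlope 1 = 0 := by
  norm_num [gapSlope, rms_one]

lemma gap_one : gap 1 = 0 := by
  norm_num [gap, rms_one]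

lemma gap_nonneg {s : ℝ} (hs : 0 < s) : 0 ≤ gap s := by
  have h1 : (1 : ℝ) ∈ Set.Ioi (0 : ℝ) := Set.mem_Ioi.mpr one_pos
  rw [← gap_one]
  rcases le_total 1 s with h | h
  · have hm : MonotoneOn gap (Set.Icc 1 s) := by
      have hpos : ∀ x ∈ Set.Icc 1 s, 0 < x := fun x hx => one_pos.trans_le hx.1
      refine monotoneOn_of_deriv_nonneg (convex_Icc 1 s)
        (fun x hx => (hasDerivAt_gap (hpos x hx)).continuousAt.continuousWithinAt)
        (fun x hx => (hasDerivAt_gap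
          (hpos x (interior_subset hx))).differentiableAt.differentiableWithinAt) fun x hx => ?_
      have hx := interior_subset hx
      have h0 := hpos x hx
      rw [(hasDerivAt_gap h0).deriv]
      have := monotoneOn_gapSlope h1 h0 hx.1
      rw [gapSlope_one] at this
      positivity
    exact hm ⟨le_rfl, h⟩ ⟨h, le_rfl⟩ h
  · have hm : AntitoneOn gap (Set.Icc s 1) := by
      have hpos : ∀ x ∈ Set.Icc s 1, 0 < x := fun x hx => hs.trans_le hx.1
      refine antitoneOn_of_deriv_nonpos (convex_Icc s 1)
        (fun x hx => (hasDerivAt_gap (hpos x hx)).continuousAt.continuousWithinAt)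
        (fun x hx => (hasDerivAt_gap
          (hpos x (interior_subset hx))).differentiableAt.differentiableWithinAt) fun x hx => ?_
      have hx := interior_subset hx
      have h0 := hpos x hx
      rw [(hasDerivAt_gap h0).deriv]
      have := monotoneOn_gapSlope h0 h1 hx.2
      rw [gapSlope_one] at this
      exact mul_nonpos_of_nonneg_of_nonpos (by positivity) this
    exact hm ⟨le_rfl, h⟩ ⟨h, le_rfl⟩ h

lemma summand_eq_mul_gap {p q : ℝ} (hp : 0 < p) (hq : 0 < q) :
    9 * ((p - q) * Real.log (p / q))
      - 8 * (((p + q) / 2) * Real.log ((p + q) / (2 * Real.sqrt (p * q))))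
      - 256 * ((p + q) / 2
        - ((Real.sqrt p + Real.sqrt q) / 2) * Real.sqrt ((p + q) / 2))
      = q * gap (Real.sqrt p / Real.sqrt q) := by
  obtain ⟨a, ha, rfl⟩ : ∃ a : ℝ, 0 < a ∧ a ^ 2 = p :=
    ⟨Real.sqrt p, Real.sqrt_pos.mpr hp, Real.sq_sqrt hp.le⟩
  obtain ⟨b, hb, rfl⟩ : ∃ b : ℝ, 0 < b ∧ b ^ 2 = q :=
    ⟨Real.sqrt q, Real.sqrt_pos.mpr hq, Real.sq_sqrt hq.le⟩
  obtain ⟨s, hs, rfl⟩ : ∃ s : ℝ, 0 < s ∧ a = s * b := ⟨a / b, by positivity, by field_simp⟩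
  have e1 : (s * b) ^ 2 / b ^ 2 = s ^ 2 := by field_simp
  have e2 : Real.sqrt ((s * b) ^ 2 * b ^ 2) = s * b ^ 2 := by
    rw [← mul_pow, Real.sqrt_sq (by positivity)]; ring
  have e3 : ((s * b) ^ 2 + b ^ 2) / (2 * (s * b ^ 2)) = (s ^ 2 + 1) / 2 / s := by
    field_simp
  have e4 : Real.sqrt (((s * b) ^ 2 + b ^ 2) / 2) = b * rms s := by
    rw [show ((s * b) ^ 2 + b ^ 2) / 2 = b ^ 2 * ((s ^ 2 + 1) / 2) by ring,
      Real.sqrt_mul (by positivity), Real.sqrt_sq hb.le, rms]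
  rw [e1, e2, e3, e4, Real.sqrt_sq (by positivity), Real.sqrt_sq hb.le,
    mul_div_cancel_right₀ _ hb.ne', Real.log_pow, Real.log_div (by positivity) hs.ne',
    Real.log_div (by positivity) two_ne_zero, gap]
  push_cast
  ring

theorem D_Td_le_D_Jd (n : ℕ) (hn : 2 ≤ n)
    (p q : Fin n → ℝ) (hp : p ∈ ProbDist n) (hq : q ∈ ProbDist n) :
    (1 / 9) * (agDiv p q - 4 * dDiv p q) ≤ (1 / 8) * jDiv p q - 4 * dDiv p q := by
  obtain ⟨hp, hp1⟩ := hp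
  obtain ⟨hq, hq1⟩ := hq
  have hd : dDiv p q = ∑ i, ((p i + q i) / 2
      - ((Real.sqrt (p i) + Real.sqrt (q i)) / 2) * Real.sqrt ((p i + q i) / 2)) := by
    rw [Finset.sum_sub_distrib, ← Finset.sum_div, Finset.sum_add_distrib, hp1, hq1, dDiv]
    norm_num
  have h : 0 ≤ 9 * jDiv p q - 8 * agDiv p q - 256 * dDiv p q := by
    rw [hd, jDiv, agDiv, Finset.mul_sum, Finset.mul_sum, Finset.mul_sum,
      ← Finset.sum_sub_distrib, ← Finset.sum_sub_distrib]
    refine Finset.sum_nonneg fun i _ => ?_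
    rw [summand_eq_mul_gap (hp i) (hq i)]
    exact mul_nonneg (hq i).le
      (gap_nonneg (div_pos (Real.sqrt_pos.mpr (hp i)) (Real.sqrt_pos.mpr (hq i))))
  linarith
end

section
/- For every n ≥ 2 and all P, Q ∈ Γₙ, one has (1/4)[(1/8)J(P||Q) − h(P||Q)] ≤ (1/8)J(P||Q) − 4d(P||Q). -/
open Real BigOperators Finset

theorem mul_log_sub_log_ge {x : ℝ} (hx : |x| < 1) :
    2 * x ^ 2 + 2 / 3 * x ^ 4 ≤ x * (Real.log (1 + x) - Real.log (1 - x)) := by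
  have hs := (Real.hasSum_log_sub_log_of_abs_lt_one hx).mul_left x
  have hle := sum_le_hasSum (range 2) (fun k _ => by
    have h : x * (2 * (1 / (2 * (k : ℝ) + 1)) * x ^ (2 * k + 1)) =
        2 * (1 / (2 * (k : ℝ) + 1)) * (x ^ (k + 1)) ^ 2 := by ring
    rw [h]
    positivity) hs
  norm_num [Finset.sum_range_succ] at hle
  linarith

theorem one_add_half_sub_le_sqrt {t : ℝ} (ht₀ : 0 ≤ t) (ht₁ : t ≤ 1) :
    1 + t / 2 - t ^ 2 / 8 ≤ √(1 + t) := by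
  apply Real.le_sqrt_of_sq_le
  nlinarith [mul_nonneg (pow_nonneg ht₀ 3) (sub_nonneg.2 ht₁), pow_nonneg ht₀ 3]

/-- The pointwise inequality in the coordinates `√p = s (1 + x)`, `√q = s (1 - x)`. -/
theorem normalized_pointwise_le {x : ℝ} (hx : |x| < 1) :
    4 * (1 + x ^ 2 - √(1 + x ^ 2)) ≤
      3 / 4 * (x * (Real.log (1 + x) - Real.log (1 - x))) + x ^ 2 / 2 := by
  have h₁ := mul_log_sub_log_ge hx
  have h₂ := one_add_half_sub_le_sqrt (sq_nonneg x) ((sq_lt_one_iff_abs_lt_one x).2 hx).le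
  nlinarith

theorem pointwise_le_of_sq {a b : ℝ} (ha : 0 < a) (hb : 0 < b) :
    4 * ((a ^ 2 + b ^ 2) / 2 - (a + b) / 2 * √((a ^ 2 + b ^ 2) / 2)) ≤
      3 / 32 * ((a ^ 2 - b ^ 2) * Real.log (a ^ 2 / b ^ 2)) + (a - b) ^ 2 / 8 := by
  obtain ⟨s, hs, x, hx, rfl, rfl⟩ : ∃ s : ℝ, 0 < s ∧ ∃ x : ℝ, |x| < 1 ∧
      a = s * (1 + x) ∧ b = s * (1 - x) := by
    refine ⟨(a + b) / 2, by positivity, (a - b) / (a + b), ?_, by field_simp; ring,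
      by field_simp; ring⟩
    rw [abs_lt, lt_div_iff₀ (by positivity), div_lt_iff₀ (by positivity)]
    constructor <;> linarith
  obtain ⟨hx₁, hx₂⟩ := abs_lt.1 hx
  have hsqrt : √(((s * (1 + x)) ^ 2 + (s * (1 - x)) ^ 2) / 2) = s * √(1 + x ^ 2) := by
    rw [show ((s * (1 + x)) ^ 2 + (s * (1 - x)) ^ 2) / 2 = s ^ 2 * (1 + x ^ 2) by ring,
      Real.sqrt_mul (sq_nonneg s), Real.sqrt_sq hs.le]
  have hlog : Real.log ((s * (1 + x)) ^ 2 / (s * (1 - x)) ^ 2) =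
      2 * (Real.log (1 + x) - Real.log (1 - x)) := by
    rw [← div_pow, mul_div_mul_left _ _ hs.ne', Real.log_pow,
      Real.log_div (by linarith) (by linarith)]
    norm_num
  rw [hsqrt, hlog]
  have h := mul_le_mul_of_nonneg_left (normalized_pointwise_le hx) (sq_nonneg s)
  linear_combination h

theorem pointwise_le {p q : ℝ} (hp : 0 < p) (hq : 0 < q) :
    4 * ((p + q) / 2 - (√p + √q) / 2 * √((p + q) / 2)) ≤
      3 / 32 * ((p - q) * Real.log (p / q)) + (√p - √q) ^ 2 / 8 := by
  simpa only [Real.sq_sqrt hp.le, Real.sq_sqrt hq.le] using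
    pointwise_le_of_sq (Real.sqrt_pos.2 hp) (Real.sqrt_pos.2 hq)

theorem D_Jh_le_D_Jd (n : ℕ) (hn : 2 ≤ n)
    (p q : Fin n → ℝ) (hp : p ∈ ProbDist n) (hq : q ∈ ProbDist n) :
    (1 / 4) * ((1 / 8) * jDiv p q - hellinger p q) ≤
      (1 / 8) * jDiv p q - 4 * dDiv p q := by
  obtain ⟨hp₀, hp₁⟩ := hp
  obtain ⟨hq₀, hq₁⟩ := hq
  have h := Finset.sum_le_sum fun i (_ : i ∈ Finset.univ) => pointwise_le (hp₀ i) (hq₀ i)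
  rw [← Finset.mul_sum, Finset.sum_sub_distrib, Finset.sum_add_distrib, ← Finset.mul_sum,
    ← Finset.sum_div, ← Finset.sum_div, Finset.sum_add_distrib, hp₁, hq₁] at h
  unfold jDiv hellinger dDiv
  linarith
end

section
/- Let 0 ≤ a < 1 < b ≤ ∞ and let f₁, f₂ : (a,b) → ℝ be twice differentiable on (a,b) with f₁(1) = f₂(1) = 0, f₂''(x) > 0 for all x ∈ (a,b), and suppose there are real constants m < M with m ≤ f₁''(x)/f₂''(x) ≤ M for all x ∈ (a,b). Then for every n ≥ 2 and all P, Q ∈ Γₙ with pᵢ/qᵢ ∈ (a,b) for all i, one has m·C_{f₂}(P||Q) ≤ C_{f₁}(P||Q) ≤ M·C_{f₂}(P||Q), where C_f(P||Q) = Σᵢ qᵢ f(pᵢ/qᵢ). -/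
open Real BigOperators Finset

/-- The Csiszár f-divergence `C_f(P‖Q) = ∑ i, q i * f (p i / q i)`. -/
noncomputable def csiszar {n : ℕ} (f : ℝ → ℝ) (p q : Fin n → ℝ) : ℝ :=
  ∑ i, q i * f (p i / q i)

/-- The real points of an extended-real open interval form a convex set. -/
theorem convex_setOf_lt_and_coe_lt (a : ℝ) (b : EReal) :
    Convex ℝ {x : ℝ | a < x ∧ (x : EReal) < b} := by
  refine Set.OrdConnected.convex ⟨fun x hx y hy z hz => ⟨hx.1.trans_le hz.1, ?_⟩⟩
  exact (EReal.coe_le_coe_iff.2 hz.2).trans_lt hy.2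

/-- A function with nonnegative second derivative on a convex set is convex there. -/
theorem convexOn_of_hasDerivAt2_nonneg {s : Set ℝ} (hs : Convex ℝ s)
    {f f' f'' : ℝ → ℝ} (hf : ∀ x ∈ s, HasDerivAt f (f' x) x)
    (hf' : ∀ x ∈ s, HasDerivAt f' (f'' x) x) (hf'' : ∀ x ∈ s, 0 ≤ f'' x) :
    ConvexOn ℝ s f := by
  refine convexOn_of_hasDerivWithinAt2_nonneg hs
    (fun x hx => (hf x hx).continuousAt.continuousWithinAt)
    (fun x hx => (hf x (interior_subset hx)).hasDerivWithinAt)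
    (fun x hx => (hf' x (interior_subset hx)).hasDerivWithinAt)
    (fun x hx => hf'' x (interior_subset hx))

/-- The Csiszár divergence of a convex function vanishing at `1` is nonnegative. -/
theorem csiszar_nonneg {s : Set ℝ} {f : ℝ → ℝ} (hf : ConvexOn ℝ s f) (hf1 : f 1 = 0)
    {n : ℕ} {p q : Fin n → ℝ} (hp : p ∈ ProbDist n) (hq : q ∈ ProbDist n)
    (hratio : ∀ i, p i / q i ∈ s) : 0 ≤ csiszar f p q := by
  have h := hf.map_sum_le (t := Finset.univ) (w := q) (p := fun i => p i / q i)
    (fun i _ => (hq.1 i).le) hq.2 (fun i _ => hratio i)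
  have hsum : ∑ i, q i • (p i / q i) = 1 := by
    rw [← hp.2]
    exact Finset.sum_congr rfl fun i _ => mul_div_cancel₀ (p i) (hq.1 i).ne'
  rw [hsum, hf1] at h
  exact h

theorem csiszar_const_mul {n : ℕ} (c : ℝ) (f : ℝ → ℝ) (p q : Fin n → ℝ) :
    csiszar (fun x => c * f x) p q = c * csiszar f p q := by
  simp only [csiszar, Finset.mul_sum]
  exact Finset.sum_congr rfl fun i _ => by ring

theorem csiszar_sub {n : ℕ} (f g : ℝ → ℝ) (p q : Fin n → ℝ) :
    csiszar (fun x => f x - g x) p q = csiszar f p q - csiszar g p q := by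
  simp only [csiszar, mul_sub, Finset.sum_sub_distrib]

/-- Csiszár divergences are monotone in the second derivative of the generating function. -/
theorem csiszar_le_csiszar_of_deriv2_le {s : Set ℝ} (hs : Convex ℝ s)
    {f f' f'' g g' g'' : ℝ → ℝ} (hf : ∀ x ∈ s, HasDerivAt f (f' x) x)
    (hf' : ∀ x ∈ s, HasDerivAt f' (f'' x) x) (hg : ∀ x ∈ s, HasDerivAt g (g' x) x)
    (hg' : ∀ x ∈ s, HasDerivAt g' (g'' x) x) (hle : ∀ x ∈ s, f'' x ≤ g'' x)
    (h1 : f 1 = g 1) {n : ℕ} {p q : Fin n → ℝ} (hp : p ∈ ProbDist n) (hq : q ∈ ProbDist n)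
    (hratio : ∀ i, p i / q i ∈ s) : csiszar f p q ≤ csiszar g p q := by
  have hconv : ConvexOn ℝ s fun x => g x - f x :=
    convexOn_of_hasDerivAt2_nonneg hs (fun x hx => (hg x hx).sub (hf x hx))
      (fun x hx => (hg' x hx).sub (hf' x hx)) (fun x hx => sub_nonneg.2 (hle x hx))
  have h := csiszar_nonneg hconv (sub_eq_zero.2 h1.symm) hp hq hratio
  rw [csiszar_sub] at h
  exact sub_nonneg.1 h

theorem csiszar_f_divergence_bounds
    (a : ℝ) (b : EReal) (ha0 : 0 ≤ a) (ha1 : a < 1) (hb1 : (1 : EReal) < b)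
    (f₁ f₂ f₁' f₂' f₁'' f₂'' : ℝ → ℝ)
    (hd₁ : ∀ x : ℝ, a < x → (x : EReal) < b → HasDerivAt f₁ (f₁' x) x)
    (hd₁' : ∀ x : ℝ, a < x → (x : EReal) < b → HasDerivAt f₁' (f₁'' x) x)
    (hd₂ : ∀ x : ℝ, a < x → (x : EReal) < b → HasDerivAt f₂ (f₂' x) x)
    (hd₂' : ∀ x : ℝ, a < x → (x : EReal) < b → HasDerivAt f₂' (f₂'' x) x)
    (hf₁1 : f₁ 1 = 0) (hf₂1 : f₂ 1 = 0)
    (hf₂pos : ∀ x : ℝ, a < x → (x : EReal) < b → 0 < f₂'' x)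
    (m M : ℝ) (hmM : m < M)
    (hml : ∀ x : ℝ, a < x → (x : EReal) < b → m ≤ f₁'' x / f₂'' x)
    (hMu : ∀ x : ℝ, a < x → (x : EReal) < b → f₁'' x / f₂'' x ≤ M)
    (n : ℕ) (hn : 2 ≤ n) (p q : Fin n → ℝ) (hp : p ∈ ProbDist n) (hq : q ∈ ProbDist n)
    (hratio : ∀ i, a < p i / q i ∧ ((p i / q i : ℝ) : EReal) < b) :
    m * csiszar f₂ p q ≤ csiszar f₁ p q ∧ csiszar f₁ p q ≤ M * csiszar f₂ p q := by
  have hs := convex_setOf_lt_and_coe_lt a b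
  rw [← csiszar_const_mul, ← csiszar_const_mul]
  constructor
  · exact csiszar_le_csiszar_of_deriv2_le hs
      (fun x hx => (hd₂ x hx.1 hx.2).const_mul m) (fun x hx => (hd₂' x hx.1 hx.2).const_mul m)
      (fun x hx => hd₁ x hx.1 hx.2) (fun x hx => hd₁' x hx.1 hx.2)
      (fun x hx => (le_div_iff₀ (hf₂pos x hx.1 hx.2)).1 (hml x hx.1 hx.2))
      (by rw [hf₁1, hf₂1, mul_zero]) hp hq hratio
  · exact csiszar_le_csiszar_of_deriv2_le hs
      (fun x hx => hd₁ x hx.1 hx.2) (fun x hx => hd₁' x hx.1 hx.2)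
      (fun x hx => (hd₂ x hx.1 hx.2).const_mul M) (fun x hx => (hd₂' x hx.1 hx.2).const_mul M)
      (fun x hx => (div_le_iff₀ (hf₂pos x hx.1 hx.2)).1 (hMu x hx.1 hx.2))
      (by rw [hf₁1, hf₂1, mul_zero]) hp hq hratio
end

section
/- For every real s and every n ≥ 2: (i) ξ_s(P||Q) ≥ 0 for all P, Q ∈ Γₙ, and (ii) the map (P,Q) ↦ ξ_s(P||Q) is convex on the convex set Γₙ × Γₙ ⊆ ℝⁿ × ℝⁿ. -/
open Real BigOperators Finset

/-- The generalized arithmetic–geometric mean divergence ξ_s(P‖Q). -/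
noncomputable def xiDiv {n : ℕ} (s : ℝ) (p q : Fin n → ℝ) : ℝ :=
  if s = 1 then jsDiv p q
  else if s = 0 then agDiv p q
  else (s * (s - 1))⁻¹ *
    ((∑ i, ((p i ^ s + q i ^ s) / 2) * ((p i + q i) / 2) ^ (1 - s)) - 1)

/-- The convex generator of `ξ_s`, normalized to vanish at `1`. -/
noncomputable def xiGenerator (s t : ℝ) : ℝ :=
  if s = 1 then t * Real.log t
  else if s = 0 then -Real.log t
  else (s * (s - 1))⁻¹ * (t ^ s - 1)

lemma xiGenerator_one (s : ℝ) : xiGenerator s 1 = 0 := by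
  simp [xiGenerator]

lemma convexOn_rpow_of_neg {s : ℝ} (hs : s < 0) :
    ConvexOn ℝ (Set.Ioi 0) fun t : ℝ => t ^ s := by
  refine ⟨convex_Ioi 0, fun x hx y hy a b ha hb hab => ?_⟩
  have hxy := convex_Ioi (0 : ℝ) hx hy ha hb hab
  have hlog := strictConcaveOn_log_Ioi.concaveOn.2 hx hy ha hb hab
  have hexp := convexOn_exp.2 (Set.mem_univ (Real.log x * s)) (Set.mem_univ (Real.log y * s))
    ha hb hab
  simp only [smul_eq_mul, Set.mem_Ioi] at *
  rw [Real.rpow_def_of_pos hxy, Real.rpow_def_of_pos hx, Real.rpow_def_of_pos hy]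
  refine le_trans (Real.exp_le_exp.2 ?_) hexp
  nlinarith

lemma convexOn_xiGenerator (s : ℝ) : ConvexOn ℝ (Set.Ioi 0) (xiGenerator s) := by
  unfold xiGenerator
  by_cases h1 : s = 1
  · simpa [h1] using Real.convexOn_mul_log.subset Set.Ioi_subset_Ici_self (convex_Ioi 0)
  by_cases h0 : s = 0
  · simp only [h0, zero_ne_one, if_true, if_false]
    exact strictConcaveOn_log_Ioi.concaveOn.neg
  simp only [h1, h0, if_false]
  rcases lt_or_gt_of_ne h0 with hs | hs
  · have hc : 0 ≤ (s * (s - 1))⁻¹ := inv_nonneg.2 (by nlinarith)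
    exact ((convexOn_rpow_of_neg hs).add_const (-1)).smul hc
  rcases lt_or_gt_of_ne h1 with hs' | hs'
  · have hc : 0 ≤ -(s * (s - 1))⁻¹ := neg_nonneg.2 (inv_nonpos.2 (by nlinarith))
    have h := (((Real.concaveOn_rpow hs.le hs'.le).subset Set.Ioi_subset_Ici_self
      (convex_Ioi 0)).neg.add_const 1).smul hc
    refine h.congr fun t _ => ?_
    simp only [smul_eq_mul, Pi.add_apply, Pi.neg_apply]
    ring
  · have hc : 0 ≤ (s * (s - 1))⁻¹ := inv_nonneg.2 (by nlinarith)
    exact (((convexOn_rpow hs'.le).subset Set.Ioi_subset_Ici_self (convex_Ioi 0)).add_const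
      (-1)).smul hc

/-- The perspective of a convex function is jointly convex. -/
lemma ConvexOn.perspective_le {g : ℝ → ℝ} (hg : ConvexOn ℝ (Set.Ioi 0) g)
    {x y u v a b : ℝ} (hx : 0 < x) (hy : 0 < y) (hu : 0 < u) (hv : 0 < v)
    (ha : 0 ≤ a) (hb : 0 ≤ b) (hab : a + b = 1) :
    (a * u + b * v) * g ((a * x + b * y) / (a * u + b * v)) ≤
      a * (u * g (x / u)) + b * (v * g (y / v)) := by
  have hw : 0 < a * u + b * v := convex_Ioi (0 : ℝ) hu hv ha hb hab
  have h := hg.2 (Set.mem_Ioi.2 (div_pos hx hu)) (Set.mem_Ioi.2 (div_pos hy hv))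
    (div_nonneg (mul_nonneg ha hu.le) hw.le) (div_nonneg (mul_nonneg hb hv.le) hw.le)
    (by field_simp)
  simp only [smul_eq_mul] at h
  have harg : a * u / (a * u + b * v) * (x / u) + b * v / (a * u + b * v) * (y / v) =
      (a * x + b * y) / (a * u + b * v) := by
    field_simp
  rw [harg] at h
  refine (mul_le_mul_of_nonneg_left h hw.le).trans_eq ?_
  field_simp

/-- The contribution of one coordinate to `ξ_s`. -/
noncomputable def xiTerm (s x y : ℝ) : ℝ :=
  ((x + y) / 2 * xiGenerator s (x / ((x + y) / 2)) +
    (x + y) / 2 * xiGenerator s (y / ((x + y) / 2))) / 2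

lemma xiTerm_nonneg (s : ℝ) {x y : ℝ} (hx : 0 < x) (hy : 0 < y) : 0 ≤ xiTerm s x y := by
  have hm : 0 < (x + y) / 2 := by positivity
  have h := (convexOn_xiGenerator s).perspective_le hx hy hm hm
    (a := 1 / 2) (b := 1 / 2) (by norm_num) (by norm_num) (by norm_num)
  have harg : (1 / 2 * x + 1 / 2 * y) / (1 / 2 * ((x + y) / 2) + 1 / 2 * ((x + y) / 2)) = 1 := by
    field_simp
    ring
  rw [harg, xiGenerator_one, mul_zero] at h
  unfold xiTerm
  linarith

lemma xiTerm_convex (s : ℝ) {x y x' y' a b : ℝ} (hx : 0 < x) (hy : 0 < y) (hx' : 0 < x')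
    (hy' : 0 < y') (ha : 0 ≤ a) (hb : 0 ≤ b) (hab : a + b = 1) :
    xiTerm s (a * x + b * x') (a * y + b * y') ≤ a * xiTerm s x y + b * xiTerm s x' y' := by
  have hm : 0 < (x + y) / 2 := by positivity
  have hm' : 0 < (x' + y') / 2 := by positivity
  have hmid : a * ((x + y) / 2) + b * ((x' + y') / 2) =
      (a * x + b * x' + (a * y + b * y')) / 2 := by ring
  have h₁ := (convexOn_xiGenerator s).perspective_le hx hx' hm hm' ha hb hab
  have h₂ := (convexOn_xiGenerator s).perspective_le hy hy' hm hm' ha hb hab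
  rw [hmid] at h₁ h₂
  unfold xiTerm
  linarith

lemma xiTerm_one {x y : ℝ} (hx : 0 < x) (hy : 0 < y) :
    xiTerm 1 x y =
      1 / 2 * (x * Real.log (2 * x / (x + y)) + y * Real.log (2 * y / (x + y))) := by
  have hx₂ : x / ((x + y) / 2) = 2 * x / (x + y) := by field_simp
  have hy₂ : y / ((x + y) / 2) = 2 * y / (x + y) := by field_simp
  simp only [xiTerm, xiGenerator, if_true, hx₂, hy₂]
  field_simp

lemma xiTerm_zero {x y : ℝ} (hx : 0 < x) (hy : 0 < y) :
    xiTerm 0 x y = (x + y) / 2 * Real.log ((x + y) / (2 * Real.sqrt (x * y))) := by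
  have hxy : 0 < x + y := by positivity
  have hlog : Real.log ((x + y) / (2 * Real.sqrt (x * y))) =
      Real.log ((x + y) / 2) - (Real.log x + Real.log y) / 2 := by
    rw [← div_div, Real.log_div (by positivity) (by positivity), Real.log_sqrt (by positivity),
      Real.log_mul hx.ne' hy.ne']
  simp only [xiTerm, xiGenerator, zero_ne_one, if_true, if_false]
  rw [hlog, Real.log_div hx.ne' (by positivity), Real.log_div hy.ne' (by positivity)]
  ring

lemma xiTerm_of_ne {s x y : ℝ} (h0 : s ≠ 0) (h1 : s ≠ 1) (hx : 0 < x) (hy : 0 < y) :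
    xiTerm s x y = (s * (s - 1))⁻¹ *
      ((x ^ s + y ^ s) / 2 * ((x + y) / 2) ^ (1 - s) - (x + y) / 2) := by
  have hm : 0 < (x + y) / 2 := by positivity
  simp only [xiTerm, xiGenerator, h0, h1, if_false]
  rw [Real.div_rpow hx.le hm.le, Real.div_rpow hy.le hm.le, Real.rpow_sub hm, Real.rpow_one]
  ring

lemma xiDiv_eq_sum_xiTerm {n : ℕ} (s : ℝ) {p q : Fin n → ℝ} (hp : p ∈ ProbDist n)
    (hq : q ∈ ProbDist n) : xiDiv s p q = ∑ i, xiTerm s (p i) (q i) := by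
  obtain ⟨hp, hp₁⟩ := hp
  obtain ⟨hq, hq₁⟩ := hq
  by_cases h1 : s = 1
  · simp only [xiDiv, h1, if_true, jsDiv, xiTerm_one (hp _) (hq _), ← Finset.mul_sum,
      Finset.sum_add_distrib]
  by_cases h0 : s = 0
  · simp only [xiDiv, h0, zero_ne_one, if_true, if_false, agDiv, xiTerm_zero (hp _) (hq _)]
  · simp only [xiDiv, h0, h1, if_false, xiTerm_of_ne h0 h1 (hp _) (hq _), ← Finset.mul_sum,
      Finset.sum_sub_distrib, ← Finset.sum_div, Finset.sum_add_distrib, hp₁, hq₁]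
    norm_num

lemma convex_probDist (n : ℕ) : Convex ℝ (ProbDist n) := by
  rintro p ⟨hp, hp₁⟩ q ⟨hq, hq₁⟩ a b ha hb hab
  refine ⟨fun i => convex_Ioi (0 : ℝ) (hp i) (hq i) ha hb hab, ?_⟩
  simp [Finset.sum_add_distrib, ← Finset.mul_sum, hp₁, hq₁, hab]

theorem xi_nonneg_and_convex (s : ℝ) (n : ℕ) (hn : 2 ≤ n) :
    (∀ p ∈ ProbDist n, ∀ q ∈ ProbDist n, 0 ≤ xiDiv s p q) ∧
    ConvexOn ℝ ((ProbDist n) ×ˢ (ProbDist n))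
      (fun x : (Fin n → ℝ) × (Fin n → ℝ) => xiDiv s x.1 x.2) := by
  refine ⟨fun p hp q hq => ?_, (convex_probDist n).prod (convex_probDist n), ?_⟩
  · rw [xiDiv_eq_sum_xiTerm s hp hq]
    exact Finset.sum_nonneg fun i _ => xiTerm_nonneg s (hp.1 i) (hq.1 i)
  · rintro ⟨p, q⟩ ⟨hp, hq⟩ ⟨p', q'⟩ ⟨hp', hq'⟩ a b ha hb hab
    have hpa := convex_probDist n hp hp' ha hb hab
    have hqa := convex_probDist n hq hq' ha hb hab
    dsimp only at hp hq hp' hq'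
    simp only [Prod.smul_mk, Prod.mk_add_mk, smul_eq_mul]
    rw [xiDiv_eq_sum_xiTerm s hpa hqa, xiDiv_eq_sum_xiTerm s hp hq,
      xiDiv_eq_sum_xiTerm s hp' hq', Finset.mul_sum, Finset.mul_sum, ← Finset.sum_add_distrib]
    exact Finset.sum_le_sum fun i _ =>
      xiTerm_convex s (hp.1 i) (hq.1 i) (hp'.1 i) (hq'.1 i) ha hb hab
end

section
/- For every n ≥ 2 and all P, Q ∈ Γₙ, the map s ↦ ζ_s(P||Q) is monotonically increasing on [1/2, ∞) and monotonically decreasing on (−∞, 1/2]; that is, for 1/2 ≤ s ≤ t one has ζ_s(P||Q) ≤ ζ_t(P||Q), and for s ≤ t ≤ 1/2 one has ζ_t(P||Q) ≤ ζ_s(P||Q). -/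
open Real BigOperators Finset

/-- The J-divergence of type s, ζ_s(P‖Q). -/
noncomputable def zeta {n : ℕ} (s : ℝ) (p q : Fin n → ℝ) : ℝ :=
  if s = 0 ∨ s = 1 then jDiv p q
  else (s * (s - 1))⁻¹ *
    ((∑ i, (p i ^ s * q i ^ (1 - s) + p i ^ (1 - s) * q i ^ s)) - 2)

/-- `(cosh (c d) - cosh d) / (c² - 1)` as a power series in `d` with coefficients
increasing in `c²`. -/
lemma hasSum_cosh_slope {c : ℝ} (hc : c ^ 2 ≠ 1) (d : ℝ) :
    HasSum (fun k : ℕ => d ^ (2 * k) / (2 * k).factorial * ∑ j ∈ range k, (c ^ 2) ^ j)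
      ((Real.cosh (c * d) - Real.cosh d) / (c ^ 2 - 1)) := by
  have h := ((Real.hasSum_cosh (c * d)).sub (Real.hasSum_cosh d)).div_const (c ^ 2 - 1)
  refine h.congr_fun ?_
  intro k
  rw [geom_sum_eq hc, mul_pow, pow_mul c]
  ring

/-- The limiting case `c² = 1` of `hasSum_cosh_slope`. -/
lemma hasSum_cosh_slope_one (d : ℝ) :
    HasSum (fun k : ℕ => d ^ (2 * k) / (2 * k).factorial * ∑ j ∈ range k, (1 : ℝ) ^ j)
      (d * Real.sinh d / 2) := by
  rw [← hasSum_nat_add_iff' 1]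
  have h := ((Real.hasSum_sinh d).mul_left d).div_const 2
  simp only [range_one, sum_singleton, range_zero, sum_empty, mul_zero, sub_zero]
  refine h.congr_fun fun k => ?_
  have hf : ((2 * (k + 1)).factorial : ℝ) = (2 * (k + 1)) * (2 * k + 1).factorial := by
    rw [show 2 * (k + 1) = (2 * k + 1) + 1 by ring, Nat.factorial_succ]
    push_cast
    ring
  have h0 : ((2 * k + 1).factorial : ℝ) ≠ 0 := by positivity
  have h1 : (k : ℝ) + 1 ≠ 0 := by positivity
  rw [hf]
  simp only [one_pow, sum_const, card_range, nsmul_eq_mul, mul_one]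
  push_cast
  field_simp
  ring

/-- The contribution of a single coordinate to `zeta`. -/
noncomputable def zetaTerm (s a b : ℝ) : ℝ :=
  if s = 0 ∨ s = 1 then (a - b) * Real.log (a / b)
  else (s * (s - 1))⁻¹ * (a ^ s * b ^ (1 - s) + a ^ (1 - s) * b ^ s - a - b)

lemma zeta_eq_sum_zetaTerm {n : ℕ} {p q : Fin n → ℝ} (hp : p ∈ ProbDist n)
    (hq : q ∈ ProbDist n) (s : ℝ) : zeta s p q = ∑ i, zetaTerm s (p i) (q i) := by
  unfold zeta zetaTerm jDiv
  split_ifs with h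
  · rfl
  · rw [← mul_sum, sum_sub_distrib, sum_sub_distrib, hp.2, hq.2]
    ring

lemma hasSum_zetaTerm {a b : ℝ} (ha : 0 < a) (hb : 0 < b) (s : ℝ) :
    HasSum (fun k : ℕ => 8 * Real.exp ((Real.log a + Real.log b) / 2) *
      (((Real.log a - Real.log b) / 2) ^ (2 * k) / (2 * k).factorial *
        ∑ j ∈ range k, ((2 * s - 1) ^ 2) ^ j)) (zetaTerm s a b) := by
  obtain ⟨x, rfl⟩ : ∃ x, Real.exp x = a := ⟨_, Real.exp_log ha⟩
  obtain ⟨y, rfl⟩ : ∃ y, Real.exp y = b := ⟨_, Real.exp_log hb⟩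
  simp only [Real.log_exp]
  have h1 : Real.exp x = Real.exp ((x + y) / 2) * Real.exp ((x - y) / 2) := by
    rw [← Real.exp_add]; ring_nf
  have h2 : Real.exp y = Real.exp ((x + y) / 2) * Real.exp (-((x - y) / 2)) := by
    rw [← Real.exp_add]; ring_nf
  unfold zetaTerm
  split_ifs with h
  · have hc : (2 * s - 1) ^ 2 = 1 := by rcases h with rfl | rfl <;> norm_num
    rw [hc]
    have hsum := (hasSum_cosh_slope_one ((x - y) / 2)).mul_left (8 * Real.exp ((x + y) / 2))
    refine Eq.subst (motive := fun v => HasSum _ v) (Eq.symm ?_) hsum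
    rw [← Real.exp_sub, Real.log_exp, Real.sinh_eq]
    rw [h1, h2]
    ring
  · push Not at h
    have hs : s * (s - 1) ≠ 0 := mul_ne_zero h.1 (sub_ne_zero.2 h.2)
    have hc : (2 * s - 1) ^ 2 - 1 = 4 * (s * (s - 1)) := by ring
    have hc1 : (2 * s - 1) ^ 2 ≠ 1 := by
      rw [← sub_ne_zero, hc]
      exact mul_ne_zero four_ne_zero hs
    have hsum := (hasSum_cosh_slope hc1 ((x - y) / 2)).mul_left (8 * Real.exp ((x + y) / 2))
    refine Eq.subst (motive := fun v => HasSum _ v) (Eq.symm ?_) hsum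
    rw [hc, Real.cosh_eq, Real.cosh_eq]
    simp only [← Real.exp_mul, ← Real.exp_add]
    have h3 : Real.exp (x * s + y * (1 - s)) =
        Real.exp ((x + y) / 2) * Real.exp ((2 * s - 1) * ((x - y) / 2)) := by
      rw [← Real.exp_add]; ring_nf
    have h4 : Real.exp (x * (1 - s) + y * s) =
        Real.exp ((x + y) / 2) * Real.exp (-((2 * s - 1) * ((x - y) / 2))) := by
      rw [← Real.exp_add]; ring_nf
    rw [h1, h2, h3, h4]
    field_simp
    ring

lemma zeta_le_zeta_of_sq_le {n : ℕ} {p q : Fin n → ℝ} (hp : p ∈ ProbDist n)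
    (hq : q ∈ ProbDist n) {s t : ℝ} (hst : (2 * s - 1) ^ 2 ≤ (2 * t - 1) ^ 2) :
    zeta s p q ≤ zeta t p q := by
  rw [zeta_eq_sum_zetaTerm hp hq, zeta_eq_sum_zetaTerm hp hq]
  refine sum_le_sum fun i _ => hasSum_le (fun k => ?_)
    (hasSum_zetaTerm (hp.1 i) (hq.1 i) s) (hasSum_zetaTerm (hp.1 i) (hq.1 i) t)
  have hd : 0 ≤ ((Real.log (p i) - Real.log (q i)) / 2) ^ (2 * k) := by
    rw [pow_mul]
    positivity
  gcongr

theorem zeta_monotone (n : ℕ) (hn : 2 ≤ n)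
    (p q : Fin n → ℝ) (hp : p ∈ ProbDist n) (hq : q ∈ ProbDist n) :
    (∀ s t : ℝ, 1 / 2 ≤ s → s ≤ t → zeta s p q ≤ zeta t p q) ∧
    (∀ s t : ℝ, s ≤ t → t ≤ 1 / 2 → zeta t p q ≤ zeta s p q) := by
  refine ⟨fun s t hs hst => zeta_le_zeta_of_sq_le hp hq ?_,
    fun s t hst ht => zeta_le_zeta_of_sq_le hp hq ?_⟩ <;> nlinarith
end
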